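/- arXiv:1709.04089 — 2 statements merged into one kernel-verified Lean document; each statement's English description precedes it below -/
import Mathlib

section
/- Let d ≥ 1 and g be the kernel -log|x| (d = 1, 2) or |x|^{2-d} (d ≥ 3). Let β > 0 and let V be continuous such that the equilibrium measure μ_V exists and such that, for N large enough, ∫ exp(-βN(V(x)/2 - log|x|)) dx < ∞ (logarithmic cases) resp. ∫ exp(-(β/2) N V(x)) dx < ∞ (Coulomb case d ≥ 3). Let ζ = h^{μ_V} + V/2 - c and ω = {x ∈ ℝ^d : ζ(x) = 0}. Then ω has finite Lebesgue measure |ω|, and lim_{N→∞} (∫_{(ℝ^d)^N} exp(-βN Σ_{i=1}^N ζ(x_i)) dx₁...dx_N)^{1/N} = lim_{N→∞} ∫_{ℝ^d} exp(-βN ζ(x)) dx = |ω|. -/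
open MeasureTheory Filter Topology
open scoped ENNReal

noncomputable section

/-- The ambient Euclidean space `ℝ^d`. -/
abbrev Esp (d : ℕ) := EuclideanSpace ℝ (Fin d)

/-- The real-valued log/Coulomb kernel: `g(x) = -log|x|` in dimensions `1, 2`,
`g(x) = |x|^(2-d)` in dimension `d ≥ 3`. -/
def gR (d : ℕ) (x : Esp d) : ℝ :=
  if d ≤ 2 then - Real.log ‖x‖ else ‖x‖ ^ (2 - (d : ℝ))

open scoped Classical in
/-- The extended-real-valued log/Coulomb kernel, equal to `+∞` at the origin. -/
def gE (d : ℕ) (x : Esp d) : EReal := if x = 0 then ⊤ else ((gR d x : ℝ) : EReal)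

/-- The integral of an extended-real-valued function (difference of the integrals of the
positive and negative parts). -/
def eIntE {α : Type*} [MeasurableSpace α] (μ : Measure α) (f : α → EReal) : EReal :=
  ((∫⁻ x, (if f x = ⊤ then ⊤ else ENNReal.ofReal (f x).toReal) ∂μ : ℝ≥0∞) : EReal)
    - ((∫⁻ x, (if f x = ⊥ then ⊤ else ENNReal.ofReal (-(f x)).toReal) ∂μ : ℝ≥0∞) : EReal)

/-- The energy functional `I_V(μ) = ∬ g(x-y) dμ(x)dμ(y) + ∫ V dμ`, written as
`∬ [g(x-y) + V(x)/2 + V(y)/2] dμ(x)dμ(y)` with extended-real values; used to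
characterize the equilibrium measure. -/
def IVE (d : ℕ) (V : Esp d → ℝ) (μ : Measure (Esp d)) : EReal :=
  eIntE (μ.prod μ) (fun p => gE d (p.1 - p.2) + ((V p.1 / 2 + V p.2 / 2 : ℝ) : EReal))

/-- The electrostatic potential `h^μ(x) = ∫ g(x-y) dμ(y)` (Bochner integral). -/
def hpot (d : ℕ) (μ : Measure (Esp d)) (x : Esp d) : ℝ :=
  ∫ y, gR d (x - y) ∂μ

/-- The (real) value `I_V(μ) = ∬ g(x-y) dμ(x)dμ(y) + ∫ V dμ` (Bochner integrals). -/
def IVr (d : ℕ) (V : Esp d → ℝ) (μ : Measure (Esp d)) : ℝ :=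
  (∫ p : Esp d × Esp d, gR d (p.1 - p.2) ∂(μ.prod μ)) + ∫ x, V x ∂μ

/-- The effective potential `ζ = h^{μ_V} + V/2 - c`, `c = I_V(μ_V) - (1/2)∫ V dμ_V`. -/
def zeta (d : ℕ) (V : Esp d → ℝ) (μ : Measure (Esp d)) (x : Esp d) : ℝ :=
  hpot d μ x + V x / 2 - (IVr d V μ - (∫ y, V y ∂μ) / 2)


/-- The logarithmic correction that makes the kernel nonnegative in dimensions `1, 2`. -/
def logCorr (d : ℕ) (x : Esp d) : ℝ := if d ≤ 2 then Real.log (1 + ‖x‖) else 0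

/-- The kernel `g(x - y)` corrected by `logCorr`, with value `0 + logCorr x + logCorr y` on the
diagonal. -/
def kerR (d : ℕ) (x y : Esp d) : ℝ := gR d (x - y) + logCorr d x + logCorr d y

open scoped Classical in
/-- The corrected kernel with values in `[0, ∞]`, equal to `∞` on the diagonal. -/
def kerE (d : ℕ) (x y : Esp d) : ℝ≥0∞ := if x = y then ⊤ else ENNReal.ofReal (kerR d x y)

/-- The corrected external field, shifted by `M`. -/
def fieldE (d : ℕ) (V : Esp d → ℝ) (M : ℝ) (x : Esp d) : ℝ≥0∞ :=
  ENNReal.ofReal (V x / 2 - logCorr d x + M)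

/-- The corrected potential of a measure. -/
def potE (d : ℕ) (μ : Measure (Esp d)) (x : Esp d) : ℝ≥0∞ := ∫⁻ y, kerE d x y ∂μ

/-- The mutual energy of two measures for the corrected kernel. -/
def mutE (d : ℕ) (μ ν : Measure (Esp d)) : ℝ≥0∞ := ∫⁻ x, potE d μ x ∂ν

section Kernel

variable {d : ℕ}

lemma logCorr_nonneg (x : Esp d) : 0 ≤ logCorr d x := by
  unfold logCorr
  split_ifs
  · exact Real.log_nonneg (by linarith [norm_nonneg x])
  · exact le_rfl

lemma continuous_logCorr : Continuous (logCorr d) := by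
  unfold logCorr
  split_ifs
  · exact Continuous.log (by fun_prop) fun x => by positivity
  · exact continuous_const

lemma measurable_gR : Measurable (gR d) := by
  unfold gR
  split_ifs
  · exact (Real.measurable_log.comp measurable_norm).neg
  · exact measurable_norm.pow_const _

lemma measurable_kerR : Measurable fun p : Esp d × Esp d => kerR d p.1 p.2 := by
  unfold kerR
  have := measurable_gR (d := d)
  have h := (continuous_logCorr (d := d)).measurable
  fun_prop

lemma measurable_kerE : Measurable fun p : Esp d × Esp d => kerE d p.1 p.2 := by
  unfold kerE
  exact Measurable.ite (measurableSet_eq_fun measurable_fst measurable_snd) measurable_const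
    measurable_kerR.ennreal_ofReal

lemma measurable_potE (μ : Measure (Esp d)) [SFinite μ] : Measurable (potE d μ) :=
  measurable_kerE.lintegral_prod_right'

lemma measurable_fieldE {V : Esp d → ℝ} (hV : Continuous V) (M : ℝ) :
    Measurable (fieldE d V M) := by
  unfold fieldE
  have h := continuous_logCorr (d := d)
  fun_prop

lemma gR_neg (x : Esp d) : gR d (-x) = gR d x := by simp [gR]

lemma kerR_comm (x y : Esp d) : kerR d x y = kerR d y x := by
  unfold kerR
  rw [← neg_sub y x, gR_neg]
  ring

lemma kerE_comm (x y : Esp d) : kerE d x y = kerE d y x := by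
  unfold kerE
  rw [kerR_comm]
  exact if_congr eq_comm rfl rfl

lemma kerR_nonneg (x y : Esp d) : 0 ≤ kerR d x y := by
  unfold kerR gR logCorr
  split_ifs
  · rcases eq_or_ne x y with rfl | h
    · have := Real.log_nonneg (show 1 ≤ 1 + ‖x‖ by linarith [norm_nonneg x])
      simp only [sub_self, norm_zero, Real.log_zero, neg_zero]
      linarith
    · have h1 : 0 < ‖x - y‖ := norm_pos_iff.2 (sub_ne_zero.2 h)
      have h2 := norm_sub_le x y
      have hx := norm_nonneg x
      have hy := norm_nonneg y
      have h3 : Real.log ‖x - y‖ ≤ Real.log ((1 + ‖x‖) * (1 + ‖y‖)) :=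
        Real.log_le_log h1 (by nlinarith)
      rw [Real.log_mul (by positivity) (by positivity)] at h3
      linarith
  · positivity

lemma mutE_eq_lintegral_prod (μ ν : Measure (Esp d)) [SFinite μ] [SFinite ν] :
    mutE d μ ν = ∫⁻ p, kerE d p.1 p.2 ∂(ν.prod μ) := by
  rw [lintegral_prod _ measurable_kerE.aemeasurable]
  rfl

lemma mutE_comm (μ ν : Measure (Esp d)) [SFinite μ] [SFinite ν] :
    mutE d μ ν = mutE d ν μ := by
  unfold mutE potE
  rw [lintegral_lintegral_swap measurable_kerE.aemeasurable]
  simp_rw [kerE_comm]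

end Kernel

section Energy

variable {d : ℕ} {V : Esp d → ℝ} {M : ℝ}

/-- The nonnegative form of the energy functional. -/
def energyE (d : ℕ) (V : Esp d → ℝ) (M : ℝ) (ν : Measure (Esp d)) : ℝ≥0∞ :=
  mutE d ν ν + 2 * ∫⁻ x, fieldE d V M x ∂ν

lemma energyE_eq_lintegral_prod (hV : Continuous V) (ν : Measure (Esp d))
    [IsProbabilityMeasure ν] :
    energyE d V M ν =
      ∫⁻ p, (kerE d p.1 p.2 + (fieldE d V M p.1 + fieldE d V M p.2)) ∂(ν.prod ν) := by
  have hf := measurable_fieldE hV M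
  rw [lintegral_add_left measurable_kerE, lintegral_add_left (by fun_prop),
    ← mutE_eq_lintegral_prod, energyE, two_mul]
  congr 2
  · exact (lintegral_map hf measurable_fst).symm.trans (by simp) |>.symm
  · exact (lintegral_map hf measurable_snd).symm.trans (by simp) |>.symm

/-- The integrand of the energy functional `IVE`. -/
def integrandE (d : ℕ) (V : Esp d → ℝ) (p : Esp d × Esp d) : EReal :=
  gE d (p.1 - p.2) + ((V p.1 / 2 + V p.2 / 2 : ℝ) : EReal)

lemma integrandE_of_ne {p : Esp d × Esp d} (hp : p.1 ≠ p.2) :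
    integrandE d V p = ((gR d (p.1 - p.2) + (V p.1 / 2 + V p.2 / 2) : ℝ) : EReal) := by
  simp [integrandE, gE, sub_eq_zero, hp]

lemma integrandE_of_eq {p : Esp d × Esp d} (hp : p.1 = p.2) : integrandE d V p = ⊤ := by
  simp only [integrandE, gE, sub_eq_zero, hp, if_true]
  exact EReal.top_add_coe _

/-- The negative part of the integrand of `IVE`, as it enters `eIntE`. -/
def negPartE (d : ℕ) (V : Esp d → ℝ) (p : Esp d × Esp d) : ℝ≥0∞ :=
  if integrandE d V p = ⊥ then ⊤ else ENNReal.ofReal (-(integrandE d V p)).toReal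

lemma negPartE_of_ne {p : Esp d × Esp d} (hp : p.1 ≠ p.2) :
    negPartE d V p = ENNReal.ofReal (-(gR d (p.1 - p.2) + (V p.1 / 2 + V p.2 / 2))) := by
  rw [negPartE, integrandE_of_ne hp, if_neg (EReal.coe_ne_bot _), ← EReal.coe_neg,
    EReal.toReal_coe]

lemma negPartE_of_eq {p : Esp d × Esp d} (hp : p.1 = p.2) : negPartE d V p = 0 := by
  simp [negPartE, integrandE_of_eq hp]

lemma measurable_negPartE (hV : Continuous V) : Measurable (negPartE d V) := by
  have h : negPartE d V = {p : Esp d × Esp d | p.1 = p.2}ᶜ.indicator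
      (fun p => ENNReal.ofReal (-(gR d (p.1 - p.2) + (V p.1 / 2 + V p.2 / 2)))) := by
    funext p
    by_cases hp : p.1 = p.2
    · simp [negPartE_of_eq hp, hp]
    · rw [Set.indicator_of_mem (by exact hp), negPartE_of_ne hp]
  rw [h]
  have := measurable_gR (d := d)
  have := hV.measurable
  exact Measurable.indicator (by fun_prop)
    (measurableSet_eq_fun measurable_fst measurable_snd).compl

lemma exists_IVE_eq (hV : Continuous V) (hM : 0 ≤ M)
    (hW : ∀ x, 0 ≤ V x / 2 - logCorr d x + M)
    (ν : Measure (Esp d)) [IsProbabilityMeasure ν] :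
    ∃ P Q : ℝ≥0∞, IVE d V ν = (P : EReal) - (Q : EReal) ∧ Q ≠ ⊤ ∧
      P + ENNReal.ofReal (2 * M) = energyE d V M ν + Q := by
  have hsplit : ∀ p : Esp d × Esp d, p.1 ≠ p.2 →
      gR d (p.1 - p.2) + (V p.1 / 2 + V p.2 / 2) + 2 * M =
      kerR d p.1 p.2 + ((V p.1 / 2 - logCorr d p.1 + M) + (V p.2 / 2 - logCorr d p.2 + M)) := by
    intro p _
    unfold kerR
    ring
  have hneg : ∀ p, negPartE d V p ≤ ENNReal.ofReal (2 * M) := by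
    intro p
    by_cases hp : p.1 = p.2
    · simp [negPartE_of_eq hp]
    · rw [negPartE_of_ne hp]
      have := hsplit p hp
      have := kerR_nonneg p.1 p.2
      exact ENNReal.ofReal_le_ofReal (by linarith [hW p.1, hW p.2])
  refine ⟨_, ∫⁻ p, negPartE d V p ∂(ν.prod ν), rfl, ?_, ?_⟩
  · refine ne_top_of_le_ne_top (b := ENNReal.ofReal (2 * M)) ENNReal.ofReal_ne_top ?_
    exact (lintegral_mono hneg).trans (by simp)
  · rw [energyE_eq_lintegral_prod hV, ← lintegral_add_right _ (measurable_negPartE hV)]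
    have h2 : ENNReal.ofReal (2 * M) =
        ∫⁻ _ : Esp d × Esp d, ENNReal.ofReal (2 * M) ∂(ν.prod ν) := by
      simp
    rw [h2, ← lintegral_add_right _ measurable_const]
    refine lintegral_congr fun p => ?_
    change (if integrandE d V p = ⊤ then ⊤ else ENNReal.ofReal (integrandE d V p).toReal) + _ = _
    by_cases hp : p.1 = p.2
    · simp [integrandE_of_eq hp, kerE, hp]
    · rw [negPartE_of_ne hp, integrandE_of_ne hp, if_neg (EReal.coe_ne_top _),
        EReal.toReal_coe, kerE, if_neg hp, fieldE, fieldE,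
        ← ENNReal.ofReal_add (hW _) (hW _),
        ← ENNReal.ofReal_add (kerR_nonneg _ _) (add_nonneg (hW _) (hW _)), ← hsplit p hp]
      set r := gR d (p.1 - p.2) + (V p.1 / 2 + V p.2 / 2)
      have hr2 : 0 ≤ r + 2 * M := by
        rw [hsplit p hp]
        exact add_nonneg (kerR_nonneg _ _) (add_nonneg (hW _) (hW _))
      rcases le_total 0 r with hr | hr
      · rw [ENNReal.ofReal_of_nonpos (p := -r) (by linarith), add_zero,
          ENNReal.ofReal_add hr (by linarith)]
      · rw [ENNReal.ofReal_of_nonpos hr, zero_add, ← ENNReal.ofReal_add hr2 (by linarith)]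
        congr 1
        ring

lemma energyE_le_of_IVE_le (hV : Continuous V) (hM : 0 ≤ M)
    (hW : ∀ x, 0 ≤ V x / 2 - logCorr d x + M)
    (μ ν : Measure (Esp d)) [IsProbabilityMeasure μ] [IsProbabilityMeasure ν]
    (h : IVE d V μ ≤ IVE d V ν) : energyE d V M μ ≤ energyE d V M ν := by
  obtain ⟨P, Q, hI, hQ, hPQ⟩ := exists_IVE_eq hV hM hW μ
  obtain ⟨P', Q', hI', hQ', hPQ'⟩ := exists_IVE_eq hV hM hW ν
  rw [hI, hI'] at h
  lift Q to NNReal using hQ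
  lift Q' to NNReal using hQ'
  by_cases hP' : P' = ⊤
  · rw [hP', top_add, eq_comm, ENNReal.add_eq_top] at hPQ'
    simp [hPQ'.resolve_right ENNReal.coe_ne_top]
  lift P' to NNReal using hP'
  by_cases hP : P = ⊤
  · rw [hP, EReal.coe_ennreal_top] at h
    exfalso
    have h1 : (⊤ : EReal) - ((Q : ℝ≥0∞) : EReal) = ⊤ := EReal.top_sub_coe (Q : ℝ)
    rw [h1, top_le_iff] at h
    exact EReal.coe_ne_top ((P' : ℝ) - (Q' : ℝ)) h
  lift P to NNReal using hP
  have h' : (P : ℝ) - Q ≤ P' - Q' := by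
    have : (((P : ℝ) - (Q : ℝ) : ℝ) : EReal) ≤ (((P' : ℝ) - (Q' : ℝ) : ℝ) : EReal) := h
    exact_mod_cast this
  have e1 : energyE d V M μ ≠ ⊤ := fun h0 => by
    rw [h0, top_add] at hPQ
    exact ENNReal.add_ne_top.2 ⟨ENNReal.coe_ne_top, ENNReal.ofReal_ne_top⟩ hPQ
  have e2 : energyE d V M ν ≠ ⊤ := fun h0 => by
    rw [h0, top_add] at hPQ'
    exact ENNReal.add_ne_top.2 ⟨ENNReal.coe_ne_top, ENNReal.ofReal_ne_top⟩ hPQ'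
  have r1 := congrArg ENNReal.toReal hPQ
  have r2 := congrArg ENNReal.toReal hPQ'
  rw [ENNReal.toReal_add ENNReal.coe_ne_top ENNReal.ofReal_ne_top,
    ENNReal.toReal_add e1 (by simp)] at r1
  rw [ENNReal.toReal_add ENNReal.coe_ne_top ENNReal.ofReal_ne_top,
    ENNReal.toReal_add e2 (by simp)] at r2
  simp only [ENNReal.coe_toReal] at r1 r2
  rw [← ENNReal.toReal_le_toReal e1 e2]
  linarith

end Energy

section Newtonian

variable {d : ℕ}

lemma lintegral_norm_rpow_ball_lt_top (hd : 1 ≤ d) {s : ℝ} (hs : s < d) :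
    ∫⁻ z in Metric.ball (0 : Esp d) 1, ENNReal.ofReal (‖z‖ ^ (-s)) < ⊤ := by
  have : Nonempty (Fin d) := ⟨⟨0, hd⟩⟩
  have h : IntegrableOn (fun z : Esp d => ‖z‖ ^ (-s)) (Metric.ball 0 1) := by
    rw [integrableOn_fun_norm_addHaar volume (f := fun y : ℝ => y ^ (-s)),
      finrank_euclideanSpace_fin]
    have h2 : IntegrableOn (fun y : ℝ => y ^ ((d : ℝ) - 1 - s)) (Set.Ioo 0 1) :=
      (intervalIntegral.integrableOn_Ioo_rpow_iff one_pos).2 (by linarith)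
    refine h2.congr_fun (fun y hy => ?_) measurableSet_Ioo
    simp only [smul_eq_mul]
    rw [← Real.rpow_natCast, ← Real.rpow_add hy.1, Nat.cast_sub hd]
    congr 1
    push_cast
    ring
  exact (hasFiniteIntegral_iff_ofReal (ae_of_all _ fun z => by positivity)).1 h.2

lemma exists_kerR_le (d : ℕ) {R : ℝ} (hR : 0 ≤ R) :
    ∃ s C : ℝ, s < max (d : ℝ) 1 ∧ 0 ≤ s ∧ 0 ≤ C ∧ ∀ x y : Esp d, ‖x‖ ≤ R → x ≠ y →
      kerR d x y ≤ C * (1 + ‖x - y‖ ^ (-s)) := by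
  by_cases hd : d ≤ 2
  · have hlog : 0 ≤ Real.log (1 + R) := Real.log_nonneg (by linarith)
    refine ⟨1 / 2, Real.log (1 + R) + 2 * √(1 + R), ?_, by norm_num, by positivity, ?_⟩
    · exact lt_of_lt_of_le (by norm_num) (le_max_right _ _)
    intro x y hx hxy
    have hr : 0 < ‖x - y‖ := norm_pos_iff.2 (sub_ne_zero.2 hxy)
    have hy : ‖y‖ ≤ R + ‖x - y‖ := by
      have := norm_sub_norm_le y x
      rw [norm_sub_rev] at this
      linarith
    simp only [kerR, gR, logCorr, hd, if_true]
    set r := ‖x - y‖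
    have h1 : Real.log (1 + ‖x‖) ≤ Real.log (1 + R) :=
      Real.log_le_log (by positivity) (by linarith)
    have h2 : Real.log (1 + ‖y‖) ≤ Real.log (r * (1 + √((1 + R) / r)) ^ 2) := by
      refine Real.log_le_log (by positivity) ?_
      have h3 : √((1 + R) / r) ^ 2 = (1 + R) / r := Real.sq_sqrt (by positivity)
      have h4 : r * ((1 + R) / r) = 1 + R := by field_simp
      have h5 : 0 ≤ √((1 + R) / r) := Real.sqrt_nonneg _
      nlinarith [mul_nonneg hr.le h5]
    rw [Real.log_mul hr.ne' (by positivity), Real.log_pow] at h2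
    have h3 : Real.log (1 + √((1 + R) / r)) ≤ √((1 + R) / r) := by
      have := Real.log_le_sub_one_of_pos (show 0 < 1 + √((1 + R) / r) by positivity)
      linarith
    have h4 : √((1 + R) / r) = √(1 + R) * r ^ (-(1 / 2) : ℝ) := by
      rw [Real.sqrt_div (by positivity), Real.rpow_neg hr.le, ← Real.sqrt_eq_rpow, div_eq_mul_inv]
    rw [h4] at h3 h2
    have h5 : 0 < r ^ (-(1 / 2) : ℝ) := by positivity
    have h6 := Real.sqrt_nonneg (1 + R)
    push_cast at h2
    nlinarith [mul_nonneg hlog h5.le]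
  · push Not at hd
    have hd' : (2 : ℝ) < d := by exact_mod_cast hd
    refine ⟨d - 2, 1, lt_of_lt_of_le (by linarith) (le_max_left _ _), by linarith, zero_le_one, ?_⟩
    intro x y _ _
    simp only [kerR, gR, logCorr, not_le.2 hd, if_false, neg_sub]
    linarith

lemma exists_lintegral_ball_kerE_le (hd : 1 ≤ d) {R : ℝ} (hR : 0 ≤ R) :
    ∃ C : ℝ≥0∞, C ≠ ⊤ ∧ ∀ y : Esp d, ∫⁻ x in Metric.ball 0 R, kerE d x y ≤ C := by
  have : Nonempty (Fin d) := ⟨⟨0, hd⟩⟩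
  obtain ⟨s, C, hs, hs0, hC, hk⟩ := exists_kerR_le d hR
  rw [max_eq_left (by exact_mod_cast hd)] at hs
  have hfin := lintegral_norm_rpow_ball_lt_top hd hs
  set K := ∫⁻ z in Metric.ball (0 : Esp d) 1, ENNReal.ofReal (‖z‖ ^ (-s)) with hK
  have hball : volume (Metric.ball (0 : Esp d) R) ≠ ⊤ := measure_ball_lt_top.ne
  refine ⟨ENNReal.ofReal C * (2 * volume (Metric.ball (0 : Esp d) R) + K), ?_, fun y => ?_⟩
  · exact ENNReal.mul_ne_top ENNReal.ofReal_ne_top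
      (ENNReal.add_ne_top.2 ⟨ENNReal.mul_ne_top (by simp) hball, hfin.ne⟩)
  let φ : Esp d → ℝ≥0∞ :=
    (Metric.ball (0 : Esp d) 1).indicator fun z => ENNReal.ofReal (‖z‖ ^ (-s))
  have hφ : Measurable φ :=
    ((measurable_norm.pow_const _).ennreal_ofReal).indicator measurableSet_ball
  have hle : ∀ᵐ x ∂(volume.restrict (Metric.ball (0 : Esp d) R)),
      kerE d x y ≤ ENNReal.ofReal C * (2 + φ (x - y)) := by
    have hy : ∀ᵐ x ∂(volume.restrict (Metric.ball (0 : Esp d) R)), x ≠ y :=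
      ae_restrict_of_ae (by simp [ae_iff])
    filter_upwards [hy, ae_restrict_mem measurableSet_ball] with x hxy hx
    rw [kerE, if_neg hxy]
    refine (ENNReal.ofReal_le_ofReal (hk x y (mem_ball_zero_iff.1 hx).le hxy)).trans ?_
    rw [ENNReal.ofReal_mul hC]
    gcongr
    rw [ENNReal.ofReal_add zero_le_one (by positivity), ENNReal.ofReal_one]
    by_cases h1 : x - y ∈ Metric.ball (0 : Esp d) 1
    · simp only [φ, Set.indicator_of_mem h1]
      gcongr
      norm_num
    · simp only [φ, Set.indicator_of_notMem h1, add_zero]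
      have h2 : 1 ≤ ‖x - y‖ := by simpa using h1
      have h3 : ‖x - y‖ ^ (-s) ≤ 1 := Real.rpow_le_one_of_one_le_of_nonpos h2 (by linarith)
      calc 1 + ENNReal.ofReal (‖x - y‖ ^ (-s)) ≤ 1 + 1 := by
            gcongr
            exact ENNReal.ofReal_le_one.2 h3
        _ = 2 := one_add_one_eq_two
  refine (lintegral_mono_ae hle).trans ?_
  rw [lintegral_const_mul _ (by fun_prop), lintegral_add_left measurable_const, setLIntegral_const]
  gcongr
  refine (setLIntegral_le_lintegral _ _).trans ?_
  rw [lintegral_sub_right_eq_self φ y, lintegral_indicator measurableSet_ball]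

lemma mutE_volume_ball_ne_top (hd : 1 ≤ d) {R : ℝ} (hR : 0 ≤ R) (μ : Measure (Esp d))
    [IsFiniteMeasure μ] : mutE d μ (volume.restrict (Metric.ball 0 R)) ≠ ⊤ := by
  obtain ⟨C, hC, h⟩ := exists_lintegral_ball_kerE_le hd hR
  rw [mutE_comm]
  refine ne_top_of_le_ne_top (ENNReal.mul_ne_top hC (measure_ne_top μ Set.univ)) ?_
  rw [← lintegral_const]
  refine lintegral_mono fun y => ?_
  unfold potE
  simp_rw [kerE_comm y]
  exact h y

end Newtonian

section LowerBound

variable {d : ℕ} {V : Esp d → ℝ}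

lemma gR_add_logCorr_le_one {x : Esp d} (hx : 1 ≤ ‖x‖) : gR d x + logCorr d x ≤ 1 := by
  unfold gR logCorr
  split_ifs with h
  · have h1 : Real.log (1 + ‖x‖) - Real.log ‖x‖ ≤ 1 := by
      rw [← Real.log_div (by positivity) (by positivity)]
      refine (Real.log_le_sub_one_of_pos (by positivity)).trans ?_
      rw [sub_le_iff_le_add, div_le_iff₀ (by positivity)]
      linarith
    linarith
  · rw [add_zero]
    refine Real.rpow_le_one_of_one_le_of_nonpos hx ?_
    have : (2 : ℝ) < d := by exact_mod_cast not_le.1 h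
    linarith

/-- A mixture of a Dirac mass at the origin and of geometrically weighted Dirac masses along a
sequence. -/
def diracMixture (x : ℕ → Esp d) (a b : ℝ≥0∞) : Measure (Esp d) :=
  a • Measure.dirac 0 + b • Measure.sum fun k => (2⁻¹ : ℝ≥0∞) ^ (k + 1) • Measure.dirac (x k)

lemma isProbabilityMeasure_diracMixture (x : ℕ → Esp d) {a b : ℝ≥0∞} (hab : a + b = 1) :
    IsProbabilityMeasure (diracMixture x a b) := by
  constructor
  simp only [diracMixture, Measure.add_apply, Measure.smul_apply, measure_univ, smul_eq_mul,
    mul_one, Measure.sum_apply _ MeasurableSet.univ]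
  rw [ENNReal.tsum_geometric_add_one, ENNReal.one_sub_inv_two, inv_inv,
    ENNReal.inv_mul_cancel (by simp) (by simp), mul_one, hab]

lemma diracMixture_apply_zero {x : ℕ → Esp d} (hx : ∀ k, x k ≠ 0) (a b : ℝ≥0∞) :
    diracMixture x a b {0} = a := by
  simp [diracMixture, Measure.sum_apply, hx]

lemma IVE_diracMixture_eq_bot (hV : Continuous V) {x : ℕ → Esp d} (hx : ∀ k, 1 ≤ ‖x k‖)
    (hxW : ∀ k, V (x k) / 2 - logCorr d (x k) ≤ -(2 ^ (k + 1) + |V 0| + 1))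
    {a b : ℝ≥0∞} (hab : a + b = 1) (ha : a ≠ 0) (hb : b ≠ 0) :
    IVE d V (diracMixture x a b) = ⊥ := by
  have hp := isProbabilityMeasure_diracMixture x hab
  have hneg : ∀ k, (2 : ℝ≥0∞) ^ (k + 1) ≤ negPartE d V (0, x k) := by
    intro k
    have hne : (0 : Esp d) ≠ x k := by
      intro h
      have := hx k
      rw [← h, norm_zero] at this
      linarith
    rw [negPartE_of_ne (p := (0, x k)) hne]
    have h1 : (2 : ℝ≥0∞) ^ (k + 1) = ENNReal.ofReal (2 ^ (k + 1)) := by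
      rw [ENNReal.ofReal_pow (by norm_num), ENNReal.ofReal_ofNat]
    rw [h1]
    apply ENNReal.ofReal_le_ofReal
    simp only [zero_sub, gR_neg]
    have h2 := gR_add_logCorr_le_one (hx k)
    have h3 := hxW k
    have h4 := le_abs_self (V 0)
    have h5 := abs_nonneg (V 0)
    linarith
  have htop : ∫⁻ p, negPartE d V p ∂((diracMixture x a b).prod (diracMixture x a b)) = ⊤ := by
    have hm := measurable_negPartE hV
    rw [lintegral_prod _ hm.aemeasurable, eq_top_iff]
    have hin : ∫⁻ y, negPartE d V (0, y) ∂(diracMixture x a b) = ⊤ := by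
      rw [eq_top_iff, diracMixture, lintegral_add_measure, lintegral_smul_measure,
        lintegral_smul_measure, lintegral_sum_measure]
      refine le_trans ?_ le_add_self
      have h1 : (⊤ : ℝ≥0∞) = ∑' _ : ℕ, (1 : ℝ≥0∞) := by simp
      rw [smul_eq_mul]
      have h2 : ∑' k, ∫⁻ y, negPartE d V (0, y)
          ∂((2⁻¹ : ℝ≥0∞) ^ (k + 1) • Measure.dirac (x k)) = ⊤ := by
        rw [eq_top_iff, h1]
        refine ENNReal.tsum_le_tsum fun k => ?_
        rw [lintegral_smul_measure, lintegral_dirac, smul_eq_mul]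
        calc (1 : ℝ≥0∞) = 2⁻¹ ^ (k + 1) * 2 ^ (k + 1) := by
              rw [← mul_pow, ENNReal.inv_mul_cancel (by simp) (by simp), one_pow]
          _ ≤ _ := by
              gcongr
              exact hneg k
      rw [h2, ENNReal.mul_top hb]
    have h3 : a * ∫⁻ y, negPartE d V (0, y) ∂(diracMixture x a b) ≤
        ∫⁻ z, ∫⁻ y, negPartE d V (z, y) ∂(diracMixture x a b) ∂(diracMixture x a b) := by
      conv_rhs => rw [diracMixture, lintegral_add_measure, lintegral_smul_measure]
      rw [lintegral_dirac, smul_eq_mul]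
      exact le_self_add
    rw [hin, ENNReal.mul_top ha] at h3
    exact h3
  change _ - ((∫⁻ p, negPartE d V p ∂_ : ℝ≥0∞) : EReal) = ⊥
  rw [htop, EReal.coe_ennreal_top, EReal.sub_top]

/-- The existence of a unique minimizer forces the corrected field to be bounded below. -/
lemma exists_lower_bound_of_unique_minimizer (hV : Continuous V) {μV : Measure (Esp d)}
    (hmin : ∀ ν : Measure (Esp d), IsProbabilityMeasure ν → IVE d V μV ≤ IVE d V ν)
    (huniq : ∀ ν : Measure (Esp d), IsProbabilityMeasure ν →
      IVE d V ν = IVE d V μV → ν = μV) :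
    ∃ M : ℝ, 0 ≤ M ∧ ∀ x, 0 ≤ V x / 2 - logCorr d x + M := by
  by_contra! hcon
  have hW : Continuous fun x => V x / 2 - logCorr d x :=
    (hV.div_const 2).sub continuous_logCorr
  obtain ⟨m, hm⟩ := (isCompact_closedBall (0 : Esp d) 1).bddBelow_image hW.continuousOn
  have hex : ∀ k : ℕ, ∃ x : Esp d, 1 ≤ ‖x‖ ∧
      V x / 2 - logCorr d x ≤ -(2 ^ (k + 1) + |V 0| + 1) := by
    intro k
    obtain ⟨x, hx⟩ := hcon (2 ^ (k + 1) + |V 0| + 1 + |m|) (by positivity)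
    have hm' := neg_abs_le m
    refine ⟨x, ?_, by linarith [abs_nonneg m]⟩
    by_contra! h
    have h1 : m ≤ V x / 2 - logCorr d x :=
      hm (Set.mem_image_of_mem _ (by simpa using h.le))
    have : (0 : ℝ) < 2 ^ (k + 1) + |V 0| + 1 := by positivity
    linarith
  choose x hx hxW using hex
  have hx0 : ∀ k, x k ≠ 0 := fun k h => by
    have := hx k
    rw [h, norm_zero] at this
    linarith
  have key : ∀ a b : ℝ≥0∞, a + b = 1 → a ≠ 0 → b ≠ 0 → μV {0} = a := by
    intro a b hab ha hb
    have hp := isProbabilityMeasure_diracMixture x hab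
    have hI := IVE_diracMixture_eq_bot hV hx hxW hab ha hb
    have h1 := hmin _ hp
    rw [hI, le_bot_iff] at h1
    rw [← huniq _ hp (hI.trans h1.symm), diracMixture_apply_zero hx0]
  have h1 := key 2⁻¹ 2⁻¹ ENNReal.inv_two_add_inv_two (by simp) (by simp)
  have h2 := key 3⁻¹ (1 - 3⁻¹) (add_tsub_cancel_of_le (by simp)) (by simp)
    (by simp [tsub_eq_zero_iff_le])
  rw [h1, inv_inj] at h2
  norm_num at h2

end LowerBound

section EulerLagrange

variable {d : ℕ} {V : Esp d → ℝ} {M : ℝ}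

lemma mutE_mixture (μ ν : Measure (Esp d)) [SFinite μ] [SFinite ν] (s t : ℝ≥0∞) :
    mutE d (s • μ + t • ν) (s • μ + t • ν) =
      s ^ 2 * mutE d μ μ + 2 * (s * t) * mutE d μ ν + t ^ 2 * mutE d ν ν := by
  have h : ∀ ρ : Measure (Esp d), SFinite ρ →
      mutE d (s • μ + t • ν) ρ = s * mutE d μ ρ + t * mutE d ν ρ := by
    intro ρ _
    have hμ := measurable_potE μ
    have hν := measurable_potE ν
    unfold mutE
    rw [← lintegral_const_mul _ hμ, ← lintegral_const_mul _ hν,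
      ← lintegral_add_left (by fun_prop)]
    simp [potE, lintegral_add_measure, lintegral_smul_measure]
  have h' : ∀ ρ : Measure (Esp d), mutE d ρ (s • μ + t • ν) = s * mutE d ρ μ + t * mutE d ρ ν := by
    intro ρ
    simp [mutE, lintegral_add_measure, lintegral_smul_measure]
  rw [h', h μ inferInstance, h ν inferInstance, mutE_comm ν μ]
  ring

lemma mutE_smul_self (ρ : Measure (Esp d)) [SFinite ρ] (c : ℝ≥0∞) :
    mutE d (c • ρ) (c • ρ) = c * (c * mutE d ρ ρ) := by
  rw [mutE, lintegral_smul_measure, smul_eq_mul, mutE, ← lintegral_const_mul _ (measurable_potE ρ)]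
  simp [potE, lintegral_smul_measure]

/-- The minimal value of the effective potential, in corrected and shifted form. -/
def levelE (d : ℕ) (V : Esp d → ℝ) (M : ℝ) (μ : Measure (Esp d)) : ℝ≥0∞ :=
  mutE d μ μ + ∫⁻ x, fieldE d V M x ∂μ

lemma levelE_ne_top_of_energyE {μ : Measure (Esp d)} (hμ : energyE d V M μ ≠ ⊤) :
    levelE d V M μ ≠ ⊤ := by
  refine ne_top_of_le_ne_top hμ ?_
  unfold levelE energyE
  gcongr
  exact le_mul_of_one_le_left' one_le_two

lemma levelE_le_lintegral {μ ν : Measure (Esp d)} [IsProbabilityMeasure μ]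
    [IsProbabilityMeasure ν]
    (hmin : ∀ ν : Measure (Esp d), IsProbabilityMeasure ν → energyE d V M μ ≤ energyE d V M ν)
    (hμ : energyE d V M μ ≠ ⊤) (hν : mutE d ν ν ≠ ⊤) :
    levelE d V M μ ≤ ∫⁻ x, (potE d μ x + fieldE d V M x) ∂ν := by
  rw [lintegral_add_left (measurable_potE μ)]
  change _ ≤ mutE d μ ν + _
  by_cases hB : mutE d μ ν = ⊤
  · simp [hB]
  by_cases hb : ∫⁻ x, fieldE d V M x ∂ν = ⊤
  · simp [hb]
  have hA : mutE d μ μ ≠ ⊤ := fun h => by simp [energyE, h] at hμ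
  have ha : ∫⁻ x, fieldE d V M x ∂μ ≠ ⊤ := fun h => by simp [energyE, h] at hμ
  have hineq : ∀ s t : NNReal, s + t = 1 →
      mutE d μ μ + 2 * ∫⁻ x, fieldE d V M x ∂μ ≤
        (s ^ 2 * mutE d μ μ + 2 * (s * t) * mutE d μ ν + t ^ 2 * mutE d ν ν) +
          2 * (s * ∫⁻ x, fieldE d V M x ∂μ + t * ∫⁻ x, fieldE d V M x ∂ν) := by
    intro s t hst
    have hp : IsProbabilityMeasure ((s : ℝ≥0∞) • μ + (t : ℝ≥0∞) • ν) := by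
      constructor
      simp only [Measure.add_apply, Measure.smul_apply, measure_univ, smul_eq_mul, mul_one]
      exact_mod_cast hst
    have := hmin _ hp
    unfold energyE at this
    rwa [mutE_mixture, lintegral_add_measure, lintegral_smul_measure, lintegral_smul_measure,
      smul_eq_mul, smul_eq_mul] at this
  unfold levelE
  lift mutE d μ μ to NNReal using hA with A
  lift ∫⁻ x, fieldE d V M x ∂μ to NNReal using ha with a
  lift mutE d μ ν to NNReal using hB with B
  lift ∫⁻ x, fieldE d V M x ∂ν to NNReal using hb with b
  lift mutE d ν ν to NNReal using hν with D
  have hr : ∀ t : ℝ, 0 ≤ t → t ≤ 1 → (A : ℝ) + 2 * a ≤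
      ((1 - t) ^ 2 * A + 2 * ((1 - t) * t) * B + t ^ 2 * D) + 2 * ((1 - t) * a + t * b) := by
    intro t h0 h1
    obtain ⟨s, hs⟩ : ∃ s : NNReal, (s : ℝ) = 1 - t := ⟨⟨1 - t, by linarith⟩, rfl⟩
    lift t to NNReal using h0
    rw [← hs]
    have h := hineq s t (by rw [← NNReal.coe_inj]; push_cast; linarith)
    exact_mod_cast h
  suffices h : (A : ℝ) + a ≤ B + b by exact_mod_cast h
  by_contra! hlt
  set ε : ℝ := A + a - (B + b) with hε
  have hε0 : 0 < ε := by linarith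
  set K : ℝ := A - 2 * B + D with hK
  have hden : 0 < ε + |K| := by positivity
  set t : ℝ := ε / (ε + |K|) with ht
  have ht0 : 0 < t := by positivity
  have ht1 : t ≤ 1 := (div_le_one hden).2 (by linarith [abs_nonneg K])
  have htK : t * |K| ≤ ε := by
    have h1 : t * (ε + |K|) = ε := by
      rw [ht]
      field_simp
    nlinarith
  have htK' : t * K ≤ ε := (mul_le_mul_of_nonneg_left (le_abs_self K) ht0.le).trans htK
  have h := hr t ht0.le ht1
  have h2 : 0 ≤ t * (t * K - 2 * ε) := by
    rw [hK, hε]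
    linarith
  nlinarith

lemma levelE_le_ae (hV : Continuous V) {μ ρ : Measure (Esp d)} [IsProbabilityMeasure μ]
    [IsFiniteMeasure ρ]
    (hmin : ∀ ν : Measure (Esp d), IsProbabilityMeasure ν → energyE d V M μ ≤ energyE d V M ν)
    (hμ : energyE d V M μ ≠ ⊤) (hρ : mutE d ρ ρ ≠ ⊤) :
    ∀ᵐ x ∂ρ, levelE d V M μ ≤ potE d μ x + fieldE d V M x := by
  set S := {x | potE d μ x + fieldE d V M x < levelE d V M μ} with hS
  have hSm : MeasurableSet S :=
    measurableSet_lt ((measurable_potE μ).add (measurable_fieldE hV M)) measurable_const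
  have hlev := levelE_ne_top_of_energyE hμ
  by_contra hcon
  have hS0 : ρ S ≠ 0 := by
    simpa [ae_iff, hS] using hcon
  set ν := (ρ S)⁻¹ • ρ.restrict S with hν
  have hνp : IsProbabilityMeasure ν := ProbabilityTheory.cond_isProbabilityMeasure hS0
  have hνS : ν Sᶜ = 0 := by simp [hν, hSm]
  have hνν : mutE d ν ν ≠ ⊤ := by
    have h2 : mutE d (ρ.restrict S) (ρ.restrict S) ≤ mutE d ρ ρ :=
      lintegral_mono' Measure.restrict_le_self
        fun x => lintegral_mono' Measure.restrict_le_self le_rfl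
    have h3 : (ρ S)⁻¹ ≠ ⊤ := ENNReal.inv_ne_top.2 hS0
    rw [hν, mutE_smul_self]
    exact ENNReal.mul_ne_top h3 (ENNReal.mul_ne_top h3 (ne_top_of_le_ne_top hρ h2))
  have hle := levelE_le_lintegral hmin hμ hνν
  have hfin : ∫⁻ x, (potE d μ x + fieldE d V M x) ∂ν ≠ ⊤ := by
    refine ne_top_of_le_ne_top (b := levelE d V M μ) hlev ?_
    have h1 : ∀ᵐ x ∂ν, potE d μ x + fieldE d V M x ≤ levelE d V M μ := by
      filter_upwards [measure_eq_zero_iff_ae_notMem.1 hνS] with x hx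
      exact (not_not.1 hx : x ∈ S).le
    exact (lintegral_mono_ae h1).trans (by simp)
  obtain ⟨x, hx, hxle⟩ := exists_notMem_null_lintegral_le hfin hνS
  exact absurd (hle.trans hxle) (not_le.2 (not_not.1 hx : x ∈ S))

lemma ae_eq_levelE (hV : Continuous V) {μ : Measure (Esp d)} [IsProbabilityMeasure μ]
    (hmin : ∀ ν : Measure (Esp d), IsProbabilityMeasure ν → energyE d V M μ ≤ energyE d V M ν)
    (hμ : energyE d V M μ ≠ ⊤) :
    ∀ᵐ x ∂μ, levelE d V M μ = potE d μ x + fieldE d V M x := by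
  have hA : mutE d μ μ ≠ ⊤ := fun h => by simp [energyE, h] at hμ
  have ha : ∫⁻ x, fieldE d V M x ∂μ ≠ ⊤ := fun h => by simp [energyE, h] at hμ
  refine ae_eq_of_ae_le_of_lintegral_le (levelE_le_ae hV hmin hμ hA) ?_ ?_ ?_
  · simpa [levelE] using ⟨hA, ha⟩
  · exact ((measurable_potE μ).add (measurable_fieldE hV M)).aemeasurable
  · rw [lintegral_add_left (measurable_potE μ)]
    simp [levelE, mutE]

end EulerLagrange

section EffectivePotential

variable {d : ℕ} {V : Esp d → ℝ} {M : ℝ}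

lemma energyE_ne_top_of_minimizer (hd : 1 ≤ d) (hV : Continuous V) {μ : Measure (Esp d)}
    (hmin : ∀ ν : Measure (Esp d), IsProbabilityMeasure ν → energyE d V M μ ≤ energyE d V M ν) :
    energyE d V M μ ≠ ⊤ := by
  set B := Metric.ball (0 : Esp d) 1
  have hB0 : volume B ≠ 0 := (Metric.measure_ball_pos volume _ one_pos).ne'
  have hBt : volume B ≠ ⊤ := measure_ball_lt_top.ne
  have : Fact (volume B < ⊤) := ⟨hBt.lt_top⟩
  have hp : IsProbabilityMeasure ((volume B)⁻¹ • (volume.restrict B) : Measure (Esp d)) :=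
    ProbabilityTheory.cond_isProbabilityMeasure_of_finite hB0 hBt
  have hinv : (volume B)⁻¹ ≠ ⊤ := ENNReal.inv_ne_top.2 hB0
  refine ne_top_of_le_ne_top ?_ (hmin _ hp)
  rw [energyE, mutE_smul_self, lintegral_smul_measure]
  refine ENNReal.add_ne_top.2 ⟨ENNReal.mul_ne_top hinv (ENNReal.mul_ne_top hinv
    (mutE_volume_ball_ne_top hd zero_le_one _)), ENNReal.mul_ne_top (by simp)
    (ENNReal.mul_ne_top hinv ?_)⟩
  have hW : Continuous fun x => V x / 2 - logCorr d x + M :=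
    ((hV.div_const 2).sub continuous_logCorr).add continuous_const
  obtain ⟨m, hm⟩ := (isCompact_closedBall (0 : Esp d) 1).bddAbove_image hW.continuousOn
  have hle : ∀ᵐ x ∂(volume.restrict B), fieldE d V M x ≤ ENNReal.ofReal m := by
    filter_upwards [ae_restrict_mem measurableSet_ball] with x hx
    exact ENNReal.ofReal_le_ofReal (hm (Set.mem_image_of_mem _ (Metric.ball_subset_closedBall hx)))
  refine ne_top_of_le_ne_top ?_ (lintegral_mono_ae hle)
  rw [setLIntegral_const]
  exact ENNReal.mul_ne_top ENNReal.ofReal_ne_top hBt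

lemma ofReal_log_sub_le_kerE (hd : d ≤ 2) {x y : Esp d} (hxy : ‖y‖ < ‖x‖) :
    ENNReal.ofReal (logCorr d y - Real.log 2) ≤ kerE d x y := by
  have hne : x ≠ y := fun h => by simp [h] at hxy
  rw [kerE, if_neg hne]
  apply ENNReal.ofReal_le_ofReal
  have h0 : 0 < ‖x - y‖ := norm_pos_iff.2 (sub_ne_zero.2 hne)
  have h1 : Real.log ‖x - y‖ ≤ Real.log (2 * (1 + ‖x‖)) :=
    Real.log_le_log h0 (by linarith [norm_sub_le x y])
  rw [Real.log_mul (by norm_num) (by positivity)] at h1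
  simp only [kerR, gR, logCorr, hd, if_true]
  linarith

lemma integrable_logCorr (hV : Continuous V) {μ : Measure (Esp d)} [IsProbabilityMeasure μ]
    (hmin : ∀ ν : Measure (Esp d), IsProbabilityMeasure ν → energyE d V M μ ≤ energyE d V M ν)
    (hμ : energyE d V M μ ≠ ⊤) : Integrable (logCorr d) μ := by
  by_cases hd : d ≤ 2
  swap
  · have : logCorr d = fun _ => 0 := by
      funext x
      simp [logCorr, hd]
    rw [this]
    exact integrable_const 0
  refine ⟨continuous_logCorr.aestronglyMeasurable, ?_⟩
  rw [hasFiniteIntegral_iff_ofReal (ae_of_all _ logCorr_nonneg)]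
  have hlev := levelE_ne_top_of_energyE hμ
  have hpot : ∀ᵐ x ∂μ, potE d μ x ≤ levelE d V M μ := by
    filter_upwards [ae_eq_levelE hV hmin hμ] with x hx
    rw [hx]
    exact le_self_add
  by_cases hn : ∃ n : ℕ, μ {x | (n : ℝ) ≤ ‖x‖} = 0
  · obtain ⟨n, hn⟩ := hn
    have hle : ∀ᵐ x ∂μ, ENNReal.ofReal (logCorr d x) ≤ ENNReal.ofReal (Real.log (1 + n)) := by
      filter_upwards [measure_eq_zero_iff_ae_notMem.1 hn] with x hx
      have hx' : ‖x‖ < n := not_le.1 hx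
      apply ENNReal.ofReal_le_ofReal
      simp only [logCorr, hd, if_true]
      exact Real.log_le_log (by positivity) (by linarith)
    refine (lintegral_mono_ae hle).trans_lt ?_
    simp
  · push Not at hn
    have hex : ∀ n : ℕ, ∃ x : Esp d, (n : ℝ) ≤ ‖x‖ ∧ potE d μ x ≤ levelE d V M μ := fun n =>
      ((frequently_ae_iff.2 (hn n)).and_eventually hpot).exists
    choose x hx hxp using hex
    have hmeas : ∀ n, Measurable fun y => kerE d (x n) y := fun n =>
      measurable_kerE.comp measurable_prodMk_left
    have hfatou := lintegral_liminf_le (μ := μ) (u := atTop) hmeas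
    have hlim : liminf (fun n => ∫⁻ y, kerE d (x n) y ∂μ) atTop ≤ levelE d V M μ :=
      liminf_le_of_frequently_le' (Frequently.of_forall hxp)
    have hpt : ∀ y, ENNReal.ofReal (logCorr d y) ≤
        liminf (fun n => kerE d (x n) y) atTop + ENNReal.ofReal (Real.log 2) := by
      intro y
      have h1 : ENNReal.ofReal (logCorr d y - Real.log 2) ≤
          liminf (fun n => kerE d (x n) y) atTop := by
        refine le_liminf_of_le (by isBoundedDefault) ?_
        obtain ⟨N, hN⟩ := exists_nat_gt ‖y‖
        filter_upwards [eventually_ge_atTop N] with n hn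
        have : (N : ℝ) ≤ n := by exact_mod_cast hn
        exact ofReal_log_sub_le_kerE hd (by linarith [hx n])
      calc ENNReal.ofReal (logCorr d y)
          = ENNReal.ofReal ((logCorr d y - Real.log 2) + Real.log 2) := by rw [sub_add_cancel]
        _ ≤ _ := ENNReal.ofReal_add_le.trans (by gcongr)
    refine (lintegral_mono hpt).trans_lt ?_
    rw [lintegral_add_right _ measurable_const]
    refine ENNReal.add_lt_top.2 ⟨(hfatou.trans hlim).trans_lt hlev.lt_top, ?_⟩
    simp

lemma integrable_and_integral_eq_toReal_lintegral {α : Type*} [MeasurableSpace α] {ρ : Measure α}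
    {k : α → ℝ≥0∞} {r : α → ℝ} (hk : Measurable k) (hr : Measurable r) (h0 : ∀ x, 0 ≤ r x)
    (hkr : ∀ x, k x ≠ ⊤ → k x = ENNReal.ofReal (r x)) (hfin : ∫⁻ x, k x ∂ρ ≠ ⊤) :
    Integrable r ρ ∧ ∫ x, r x ∂ρ = (∫⁻ x, k x ∂ρ).toReal := by
  have hae : ∀ᵐ x ∂ρ, k x = ENNReal.ofReal (r x) := by
    filter_upwards [ae_lt_top hk hfin] with x hx using hkr x hx.ne
  rw [lintegral_congr_ae hae] at hfin ⊢
  refine ⟨⟨hr.aestronglyMeasurable, ?_⟩, ?_⟩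
  · rw [hasFiniteIntegral_iff_ofReal (ae_of_all _ h0)]
    exact hfin.lt_top
  · exact integral_eq_lintegral_of_nonneg_ae (ae_of_all _ h0) hr.aestronglyMeasurable

lemma kerE_eq_ofReal_of_ne_top {x y : Esp d} (h : kerE d x y ≠ ⊤) :
    kerE d x y = ENNReal.ofReal (kerR d x y) := by
  unfold kerE at h ⊢
  split_ifs at h ⊢
  · exact absurd rfl h
  · rfl

lemma hpot_eq {μ : Measure (Esp d)} [IsProbabilityMeasure μ] (hL : Integrable (logCorr d) μ)
    {x : Esp d} (hx : potE d μ x ≠ ⊤) :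
    hpot d μ x = (potE d μ x).toReal - logCorr d x - ∫ y, logCorr d y ∂μ := by
  have hk : Measurable fun y => kerE d x y := measurable_kerE.comp measurable_prodMk_left
  have hr : Measurable (kerR d x) :=
    Measurable.of_uncurry_left (f := kerR d) (x := x) measurable_kerR
  have hfin : ∫⁻ y, kerE d x y ∂μ ≠ ⊤ := hx
  have hkr : ∀ y, kerE d x y ≠ ⊤ → kerE d x y = ENNReal.ofReal (kerR d x y) :=
    fun y h => kerE_eq_ofReal_of_ne_top h
  obtain ⟨hint, heq⟩ := integrable_and_integral_eq_toReal_lintegral hk hr (kerR_nonneg x) hkr hfin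
  have h1 : ∀ y, gR d (x - y) = kerR d x y - logCorr d x - logCorr d y := fun y => by
    unfold kerR
    ring
  have hsub : Integrable (fun y => kerR d x y - logCorr d x) μ := hint.sub (integrable_const _)
  have h2 : ∫ y, kerR d x y - logCorr d x ∂μ = (∫⁻ y, kerE d x y ∂μ).toReal - logCorr d x := by
    rw [integral_sub hint (integrable_const _), heq, integral_const, probReal_univ, one_smul]
  rw [hpot, integral_congr_ae (ae_of_all _ h1), integral_sub hsub hL, h2, potE]

lemma integral_prod_gR_eq {μ : Measure (Esp d)} [IsProbabilityMeasure μ]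
    (hL : Integrable (logCorr d) μ) (hA : mutE d μ μ ≠ ⊤) :
    ∫ p : Esp d × Esp d, gR d (p.1 - p.2) ∂(μ.prod μ) =
      (mutE d μ μ).toReal - 2 * ∫ y, logCorr d y ∂μ := by
  rw [mutE_eq_lintegral_prod] at hA ⊢
  obtain ⟨hint, heq⟩ := integrable_and_integral_eq_toReal_lintegral
    measurable_kerE measurable_kerR (fun p => kerR_nonneg p.1 p.2)
    (fun p => kerE_eq_ofReal_of_ne_top) hA
  have h1 : ∀ p : Esp d × Esp d,
      gR d (p.1 - p.2) = kerR d p.1 p.2 - logCorr d p.1 - logCorr d p.2 := fun p => by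
    unfold kerR
    ring
  simp_rw [h1]
  have hsub : Integrable (fun p : Esp d × Esp d => kerR d p.1 p.2 - logCorr d p.1) (μ.prod μ) :=
    hint.sub (hL.comp_fst μ)
  rw [integral_sub hsub (hL.comp_snd μ), integral_sub hint (hL.comp_fst μ),
    heq, integral_fun_fst, integral_fun_snd]
  simp
  ring

lemma integral_field_eq (hV : Continuous V) (hW : ∀ x, 0 ≤ V x / 2 - logCorr d x + M)
    {μ : Measure (Esp d)} [IsProbabilityMeasure μ] (hL : Integrable (logCorr d) μ)
    (ha : ∫⁻ x, fieldE d V M x ∂μ ≠ ⊤) :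
    ∫ x, V x ∂μ =
      2 * (∫⁻ x, fieldE d V M x ∂μ).toReal + 2 * (∫ y, logCorr d y ∂μ) - 2 * M := by
  have hm : Measurable fun x => V x / 2 - logCorr d x + M :=
    (((hV.div_const 2).sub continuous_logCorr).add continuous_const).measurable
  obtain ⟨hint, heq⟩ := integrable_and_integral_eq_toReal_lintegral
    (measurable_fieldE hV M) hm hW (fun x _ => rfl) ha
  have h1 : ∀ x, V x = 2 * (V x / 2 - logCorr d x + M) + 2 * logCorr d x - 2 * M := fun x => by
    ring
  have hadd : Integrable (fun x => 2 * (V x / 2 - logCorr d x + M) + 2 * logCorr d x) μ :=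
    (hint.const_mul 2).add (hL.const_mul 2)
  rw [integral_congr_ae (ae_of_all _ h1), integral_sub hadd (integrable_const _),
    integral_add (hint.const_mul 2) (hL.const_mul 2), integral_const_mul,
    integral_const_mul, heq]
  simp

lemma zeta_eq (hV : Continuous V) (hW : ∀ x, 0 ≤ V x / 2 - logCorr d x + M)
    {μ : Measure (Esp d)} [IsProbabilityMeasure μ] (hL : Integrable (logCorr d) μ)
    (hμ : energyE d V M μ ≠ ⊤) {x : Esp d} (hx : potE d μ x ≠ ⊤) :
    zeta d V μ x = (potE d μ x).toReal + (V x / 2 - logCorr d x + M) -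
      (levelE d V M μ).toReal := by
  have hA : mutE d μ μ ≠ ⊤ := fun h => by simp [energyE, h] at hμ
  have ha : ∫⁻ x, fieldE d V M x ∂μ ≠ ⊤ := fun h => by simp [energyE, h] at hμ
  rw [zeta, IVr, hpot_eq hL hx, integral_prod_gR_eq hL hA, integral_field_eq hV hW hL ha, levelE,
    ENNReal.toReal_add hA ha]
  ring

lemma ae_potE_ne_top (hd : 1 ≤ d) (μ : Measure (Esp d)) [IsFiniteMeasure μ] :
    ∀ᵐ x : Esp d, potE d μ x ≠ ⊤ := by
  have h : ∀ n : ℕ, ∀ᵐ x : Esp d, x ∈ Metric.ball (0 : Esp d) n → potE d μ x ≠ ⊤ := by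
    intro n
    rw [← ae_restrict_iff' measurableSet_ball]
    filter_upwards [ae_lt_top (measurable_potE μ)
      (mutE_volume_ball_ne_top hd (Nat.cast_nonneg n) μ)] with x hx using hx.ne
  filter_upwards [ae_all_iff.2 h] with x hx
  obtain ⟨n, hn⟩ := exists_nat_gt ‖x‖
  exact hx n (by simpa using hn)

lemma ae_levelE_le (hd : 1 ≤ d) (hV : Continuous V) {μ : Measure (Esp d)} [IsProbabilityMeasure μ]
    (hmin : ∀ ν : Measure (Esp d), IsProbabilityMeasure ν → energyE d V M μ ≤ energyE d V M ν)
    (hμ : energyE d V M μ ≠ ⊤) :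
    ∀ᵐ x : Esp d, levelE d V M μ ≤ potE d μ x + fieldE d V M x := by
  have h : ∀ n : ℕ, ∀ᵐ x : Esp d, x ∈ Metric.ball (0 : Esp d) n →
      levelE d V M μ ≤ potE d μ x + fieldE d V M x := by
    intro n
    have : Fact (volume (Metric.ball (0 : Esp d) n) < ⊤) := ⟨measure_ball_lt_top⟩
    rw [← ae_restrict_iff' measurableSet_ball]
    exact levelE_le_ae hV hmin hμ (mutE_volume_ball_ne_top hd (Nat.cast_nonneg n) _)
  filter_upwards [ae_all_iff.2 h] with x hx
  obtain ⟨n, hn⟩ := exists_nat_gt ‖x‖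
  exact hx n (by simpa using hn)

/-- The effective potential of the equilibrium measure is almost everywhere nonnegative and grows
at least as fast as the corrected field. -/
lemma zeta_nonneg_and_lower_bound (hd : 1 ≤ d) (hV : Continuous V)
    {μV : Measure (Esp d)} [IsProbabilityMeasure μV]
    (hmin : ∀ ν : Measure (Esp d), IsProbabilityMeasure ν → IVE d V μV ≤ IVE d V ν)
    (huniq : ∀ ν : Measure (Esp d), IsProbabilityMeasure ν →
      IVE d V ν = IVE d V μV → ν = μV) :
    (∀ᵐ x : Esp d, 0 ≤ zeta d V μV x) ∧
      ∃ C : ℝ, ∀ᵐ x : Esp d, V x / 2 - logCorr d x - C ≤ zeta d V μV x := by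
  obtain ⟨M, hM, hW⟩ := exists_lower_bound_of_unique_minimizer hV hmin huniq
  have hmin' : ∀ ν : Measure (Esp d), IsProbabilityMeasure ν →
      energyE d V M μV ≤ energyE d V M ν :=
    fun ν hν => energyE_le_of_IVE_le hV hM hW μV ν (hmin ν hν)
  have hμ := energyE_ne_top_of_minimizer hd hV hmin'
  have hL := integrable_logCorr hV hmin' hμ
  have hlev := levelE_ne_top_of_energyE hμ
  refine ⟨?_, (levelE d V M μV).toReal - M, ?_⟩
  · filter_upwards [ae_potE_ne_top hd μV, ae_levelE_le hd hV hmin' hμ] with x hx hle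
    rw [zeta_eq hV hW hL hμ hx]
    have h := ENNReal.toReal_mono (ENNReal.add_ne_top.2 ⟨hx, ENNReal.ofReal_ne_top⟩) hle
    rw [ENNReal.toReal_add hx ENNReal.ofReal_ne_top, ENNReal.toReal_ofReal (hW x)] at h
    linarith
  · filter_upwards [ae_potE_ne_top hd μV] with x hx
    rw [zeta_eq hV hW hL hμ hx]
    have : 0 ≤ (potE d μV x).toReal := ENNReal.toReal_nonneg
    linarith

end EffectivePotential

section Laplace

variable {d : ℕ} {V : Esp d → ℝ}

lemma measurable_zeta (hV : Continuous V) (μ : Measure (Esp d)) [SFinite μ] :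
    Measurable (zeta d V μ) := by
  have h : StronglyMeasurable fun p : Esp d × Esp d => gR d (p.1 - p.2) :=
    (measurable_gR.comp measurable_sub).stronglyMeasurable
  have hpot_meas : Measurable (hpot d μ) := h.integral_prod_right.measurable
  unfold zeta
  exact (hpot_meas.add (hV.measurable.div_const 2)).sub measurable_const

lemma lintegral_exp_field_ne_top {β M : ℝ} (hβ : 0 < β)
    (hW : ∀ x, 0 ≤ V x / 2 - logCorr d x + M)
    (hA3log : d ≤ 2 → ∃ N₀ : ℕ, ∀ N ≥ N₀,
      (∫⁻ x : Esp d, ENNReal.ofReal (Real.exp (-β * N * (V x / 2 - Real.log ‖x‖)))) ≠ ⊤)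
    (hA3coul : 3 ≤ d → ∃ N₀ : ℕ, ∀ N ≥ N₀,
      (∫⁻ x : Esp d, ENNReal.ofReal (Real.exp (-(β / 2) * N * V x))) ≠ ⊤) :
    ∃ N : ℕ, ∫⁻ x : Esp d, ENNReal.ofReal (Real.exp (-β * N * (V x / 2 - logCorr d x))) ≠ ⊤ := by
  by_cases hd : d ≤ 2
  · obtain ⟨N, hN⟩ := hA3log hd
    refine ⟨N, ?_⟩
    have hβN : 0 ≤ β * N := by positivity
    rw [← lintegral_add_compl _ (measurableSet_ball (x := (0 : Esp d)) (ε := 1))]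
    refine ENNReal.add_ne_top.2 ⟨?_, ?_⟩
    · refine ne_top_of_le_ne_top (b := ENNReal.ofReal (Real.exp (β * N * M)) *
        volume (Metric.ball (0 : Esp d) 1))
        (ENNReal.mul_ne_top ENNReal.ofReal_ne_top measure_ball_lt_top.ne) ?_
      rw [← setLIntegral_const]
      refine lintegral_mono fun x => ?_
      refine ENNReal.ofReal_le_ofReal (Real.exp_le_exp.2 ?_)
      nlinarith [mul_nonneg hβN (hW x)]
    · refine ne_top_of_le_ne_top (b := ENNReal.ofReal (Real.exp (β * N * Real.log 2)) *
        ∫⁻ x : Esp d, ENNReal.ofReal (Real.exp (-β * N * (V x / 2 - Real.log ‖x‖))))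
        (ENNReal.mul_ne_top ENNReal.ofReal_ne_top (hN N le_rfl)) ?_
      rw [← lintegral_const_mul' _ _ ENNReal.ofReal_ne_top]
      refine (setLIntegral_mono' measurableSet_ball.compl fun x hx => ?_).trans
        (setLIntegral_le_lintegral _ _)
      have hx1 : 1 ≤ ‖x‖ := by simpa using hx
      have hlog : logCorr d x ≤ Real.log 2 + Real.log ‖x‖ := by
        rw [← Real.log_mul (by norm_num) (by positivity)]
        simp only [logCorr, hd, if_true]
        exact Real.log_le_log (by positivity) (by linarith)
      rw [← ENNReal.ofReal_mul (Real.exp_pos _).le, ← Real.exp_add]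
      gcongr
      nlinarith [mul_le_mul_of_nonneg_left hlog hβN]
  · obtain ⟨N, hN⟩ := hA3coul (by omega)
    refine ⟨N, ?_⟩
    convert hN N le_rfl using 5 with x
    simp only [logCorr, hd, if_false]
    ring

lemma lintegral_exp_ne_top_of_ae_le {β C : ℝ} (hβ : 0 < β) {W ζ : Esp d → ℝ}
    (hC : ∀ᵐ x : Esp d, W x - C ≤ ζ x) {N : ℕ}
    (hN : ∫⁻ x : Esp d, ENNReal.ofReal (Real.exp (-β * N * W x)) ≠ ⊤) :
    ∫⁻ x : Esp d, ENNReal.ofReal (Real.exp (-β * N * ζ x)) ≠ ⊤ := by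
  have hβN : 0 ≤ β * N := by positivity
  refine ne_top_of_le_ne_top (b := ENNReal.ofReal (Real.exp (β * N * C)) *
    ∫⁻ x : Esp d, ENNReal.ofReal (Real.exp (-β * N * W x)))
    (ENNReal.mul_ne_top ENNReal.ofReal_ne_top hN) ?_
  rw [← lintegral_const_mul' _ _ ENNReal.ofReal_ne_top]
  refine lintegral_mono_ae ?_
  filter_upwards [hC] with x hx
  rw [← ENNReal.ofReal_mul (Real.exp_pos _).le, ← Real.exp_add]
  gcongr
  nlinarith [mul_le_mul_of_nonneg_left hx hβN]

end Laplace

/-- The Laplace method at zero temperature: for a nonnegative `f` whose exponential is eventually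
integrable, the integrals of `exp (-βN f)` converge to the measure of the zero set of `f`. -/
lemma tendsto_lintegral_exp_measure_zero_set {α : Type*} [MeasurableSpace α] {ρ : Measure α}
    {f : α → ℝ} (hf : Measurable f) (h0 : ∀ᵐ x ∂ρ, 0 ≤ f x) {β : ℝ} (hβ : 0 < β) {N₀ : ℕ}
    (hN₀ : ∫⁻ x, ENNReal.ofReal (Real.exp (-β * N₀ * f x)) ∂ρ ≠ ⊤) :
    ρ {x | f x = 0} ≠ ⊤ ∧
    Tendsto (fun N : ℕ => ∫⁻ x, ENNReal.ofReal (Real.exp (-β * N * f x)) ∂ρ) atTop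
      (𝓝 (ρ {x | f x = 0})) := by
  have hS : MeasurableSet {x | f x = 0} := hf (measurableSet_singleton 0)
  rw [← lintegral_indicator_one hS]
  constructor
  · refine ne_top_of_le_ne_top hN₀ (lintegral_mono fun x => ?_)
    by_cases hx : f x = 0
    · simp [hx]
    · simp [Set.indicator, hx]
  refine tendsto_lintegral_filter_of_dominated_convergence _ (Eventually.of_forall fun N => ?_)
    ?_ hN₀ ?_
  · fun_prop
  · filter_upwards [eventually_ge_atTop N₀] with N hN
    filter_upwards [h0] with x hx
    have hN' : (N₀ : ℝ) ≤ N := by exact_mod_cast hN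
    gcongr ENNReal.ofReal (Real.exp ?_)
    nlinarith [mul_le_mul_of_nonneg_left hN' (mul_nonneg hβ.le hx)]
  · filter_upwards [h0] with x hx
    by_cases h : f x = 0
    · simp [h]
    · have hpos : 0 < β * f x := mul_pos hβ (lt_of_le_of_ne hx (Ne.symm h))
      have hlim : Tendsto (fun N : ℕ => Real.exp (-β * N * f x)) atTop (𝓝 0) := by
        refine Real.tendsto_exp_neg_atTop_nhds_zero.comp
          (tendsto_natCast_atTop_atTop.const_mul_atTop hpos) |>.congr fun N => ?_
        simp only [Function.comp_apply]
        congr 1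
        ring
      simpa [Set.indicator, h] using ENNReal.tendsto_ofReal hlim

lemma lintegral_fin_prod_eq_pow {E : Type*} [MeasureSpace E] [SigmaFinite (volume : Measure E)]
    {f : E → ℝ≥0∞} (hf : Measurable f) (n : ℕ) :
    ∫⁻ X : Fin n → E, ∏ i, f (X i) = (∫⁻ x, f x) ^ n := by
  induction n with
  | zero => simp [volume_pi]
  | succ n ih =>
    have hmp := (volume_preserving_piFinSuccAbove (fun _ : Fin (n + 1) => E) 0).symm
    rw [← hmp.lintegral_comp_emb (MeasurableEquiv.measurableEmbedding _)]
    simp only [Fin.prod_univ_succ]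
    have hprod : Measurable fun X : Fin n → E => ∏ i, f (X i) :=
      Finset.measurable_fun_prod _ fun i _ => hf.comp (measurable_pi_apply i)
    rw [pow_succ', ← ih, ← lintegral_prod_mul hf.aemeasurable hprod.aemeasurable]
    rfl

/-- the zero set `ω = {ζ = 0}` has finite Lebesgue measure `|ω|`, and
`(∫_{(ℝ^d)^N} e^{-βN Σᵢ ζ(xᵢ)} dX_N)^{1/N} → |ω|` as well as
`∫_{ℝ^d} e^{-βN ζ(x)} dx → |ω|` as `N → ∞`. -/
theorem statement_12 (d : ℕ) (hd : 1 ≤ d) (β : ℝ) (hβ : 0 < β) (V : Esp d → ℝ)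
    (hV : Continuous V)
    (μV : Measure (Esp d)) (hprob : IsProbabilityMeasure μV)
    (hmin : ∀ ν : Measure (Esp d), IsProbabilityMeasure ν → IVE d V μV ≤ IVE d V ν)
    (huniq : ∀ ν : Measure (Esp d), IsProbabilityMeasure ν →
      IVE d V ν = IVE d V μV → ν = μV)
    (hA3log : d ≤ 2 → ∃ N₀ : ℕ, ∀ N ≥ N₀,
      (∫⁻ x : Esp d, ENNReal.ofReal (Real.exp (-β * N * (V x / 2 - Real.log ‖x‖)))) ≠ ⊤)
    (hA3coul : 3 ≤ d → ∃ N₀ : ℕ, ∀ N ≥ N₀,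
      (∫⁻ x : Esp d, ENNReal.ofReal (Real.exp (-(β / 2) * N * V x))) ≠ ⊤) :
    volume {x : Esp d | zeta d V μV x = 0} ≠ ⊤ ∧
    Tendsto (fun N : ℕ =>
        (∫⁻ X : Fin N → Esp d,
            ENNReal.ofReal (Real.exp (-β * N * ∑ i, zeta d V μV (X i)))) ^ ((N : ℝ)⁻¹))
      atTop (𝓝 (volume {x : Esp d | zeta d V μV x = 0})) ∧
    Tendsto (fun N : ℕ =>
        ∫⁻ x : Esp d, ENNReal.ofReal (Real.exp (-β * N * zeta d V μV x)))
      atTop (𝓝 (volume {x : Esp d | zeta d V μV x = 0})) := by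
  obtain ⟨h0, C, hC⟩ := zeta_nonneg_and_lower_bound hd hV hmin huniq
  obtain ⟨M, -, hW⟩ := exists_lower_bound_of_unique_minimizer hV hmin huniq
  obtain ⟨N₀, hN₀⟩ := lintegral_exp_field_ne_top hβ hW hA3log hA3coul
  have hζ := measurable_zeta hV μV
  obtain ⟨hfin, hlim⟩ := tendsto_lintegral_exp_measure_zero_set hζ h0 hβ
    (lintegral_exp_ne_top_of_ae_le hβ hC hN₀)
  refine ⟨hfin, hlim.congr' ?_, hlim⟩
  filter_upwards [eventually_ne_atTop 0] with N hN
  have hprod : ∀ X : Fin N → Esp d, ENNReal.ofReal (Real.exp (-β * N * ∑ i, zeta d V μV (X i))) =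
      ∏ i, ENNReal.ofReal (Real.exp (-β * N * zeta d V μV (X i))) := fun X => by
    rw [Finset.mul_sum, Real.exp_sum, ENNReal.ofReal_prod_of_nonneg fun _ _ => (Real.exp_pos _).le]
  simp_rw [hprod]
  rw [lintegral_fin_prod_eq_pow (f := fun x => ENNReal.ofReal (Real.exp (-β * N * zeta d V μV x)))
    (by fun_prop), ENNReal.pow_rpow_inv_natCast hN]
end
end

section
/- Let d ≥ 3 and g(x) = |x|^{2-d}. Assume V : ℝ^d → ℝ is lower semi-continuous, bounded below, finite on a set of positive Lebesgue measure, and satisfies lim_{|x|→∞} (V(x)/2 + g(x)) = +∞, and let μ_V be the unique minimizer of I_V over probability measures on ℝ^d. For each N, let (x₁^N,...,x_N^N) be a minimizer of H_N over (ℝ^d)^N. Then the empirical measures (1/N) Σ_{i=1}^N δ_{x_i^N} converge weakly to μ_V as N → ∞. -/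
open MeasureTheory Filter Topology
open scoped ENNReal

noncomputable section

/-- The `[0,∞]`-valued Coulomb kernel `g(x) = |x|^(2-d)`, `d ≥ 3` (equal to `+∞` at the
origin). -/
def coulK (d : ℕ) (x : Esp d) : ℝ≥0∞ := (ENNReal.ofReal ‖x‖) ^ (2 - (d : ℝ))

/-- The Coulomb interaction energy `∬ g(x-y) dμ(x) dμ(y) ∈ [0,∞]`. -/
def doubleEnergy (d : ℕ) (μ : Measure (Esp d)) : ℝ≥0∞ :=
  ∫⁻ p : Esp d × Esp d, coulK d (p.1 - p.2) ∂(μ.prod μ)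

/-- Integral of a real-valued function against a measure, with values in the extended
reals (difference of the integrals of the positive and negative parts). -/
def eIntR {α : Type*} [MeasurableSpace α] (μ : Measure α) (f : α → ℝ) : EReal :=
  ((∫⁻ x, ENNReal.ofReal (f x) ∂μ : ℝ≥0∞) : EReal)
    - ((∫⁻ x, ENNReal.ofReal (- f x) ∂μ : ℝ≥0∞) : EReal)

/-- The mean-field energy functional `I_V(μ) = ∬ g(x-y) dμ(x)dμ(y) + ∫ V dμ ∈ (-∞,+∞]`. -/
def IV (d : ℕ) (V : Esp d → ℝ) (μ : Measure (Esp d)) : EReal :=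
  (doubleEnergy d μ : EReal) + eIntR μ V

/-- The `N`-point Hamiltonian `H_N = Σ_{i≠j} g(x_i-x_j) + N Σ_i V(x_i)`, valued in the
extended reals (`+∞` when two points coincide). -/
def HN3 (d N : ℕ) (V : Esp d → ℝ) (X : Fin N → Esp d) : EReal :=
  (((∑ i, ∑ j, if i ≠ j then coulK d (X i - X j) else 0) : ℝ≥0∞) : EReal)
    + ((N * ∑ i, V (X i) : ℝ) : EReal)

namespace CoulombGas

lemma measurable_coulK (d : ℕ) : Measurable (coulK d) := by
  unfold coulK
  fun_prop

/-- The portmanteau inequality for nonnegative lower semicontinuous functions. -/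
lemma lintegral_le_liminf_of_lowerSemicontinuous {Ω : Type*} [MeasurableSpace Ω]
    [TopologicalSpace Ω] [OpensMeasurableSpace Ω] [HasOuterApproxClosed Ω]
    {μ : ProbabilityMeasure Ω} {μs : ℕ → ProbabilityMeasure Ω}
    (hμ : Tendsto μs atTop (𝓝 μ)) {f : Ω → ℝ} (hf : LowerSemicontinuous f) (hf0 : 0 ≤ f) :
    ∫⁻ x, ENNReal.ofReal (f x) ∂(μ : Measure Ω) ≤
      atTop.liminf fun i => ∫⁻ x, ENNReal.ofReal (f x) ∂(μs i : Measure Ω) := by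
  simp_rw [lintegral_eq_lintegral_meas_lt _ (Eventually.of_forall hf0) hf.measurable.aemeasurable]
  refine (lintegral_mono fun t => ProbabilityMeasure.le_liminf_measure_open_of_tendsto hμ
    (hf.isOpen_preimage t)).trans ?_
  exact lintegral_liminf_le fun n => Antitone.measurable fun s t hst =>
    measure_mono fun ω hω => lt_of_le_of_lt hst hω

/-- The external potential shifted by `K` and truncated to be nonnegative. -/
def shifted {d : ℕ} (V : Esp d → ℝ) (K : ℝ) (x : Esp d) : ℝ≥0∞ := ENNReal.ofReal (V x + K)

/-- The nonnegative mean-field energy for the shifted potential. -/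
def shiftedEnergy (d : ℕ) (V : Esp d → ℝ) (K : ℝ) (μ : Measure (Esp d)) : ℝ≥0∞ :=
  doubleEnergy d μ + ∫⁻ x, shifted V K x ∂μ

/-- The nonnegative Hamiltonian for the shifted potential. -/
def shiftedHamiltonian (d N : ℕ) (V : Esp d → ℝ) (K : ℝ) (X : Fin N → Esp d) : ℝ≥0∞ :=
  (∑ i, ∑ j, if i ≠ j then coulK d (X i - X j) else 0) + N * ∑ i, shifted V K (X i)

lemma IV_add {d : ℕ} {V : Esp d → ℝ} {K : ℝ} (hV : Measurable V) (hK : 0 ≤ K)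
    (hVK : ∀ x, 0 ≤ V x + K) (μ : Measure (Esp d)) [IsProbabilityMeasure μ] :
    IV d V μ + (K : EReal) = (shiftedEnergy d V K μ : EReal) := by
  have hsplit : (∫⁻ x, ENNReal.ofReal (V x) ∂μ) + ENNReal.ofReal K
      = (∫⁻ x, shifted V K x ∂μ) + ∫⁻ x, ENNReal.ofReal (-V x) ∂μ := by
    have h1 : ENNReal.ofReal K = ∫⁻ _, ENNReal.ofReal K ∂μ := by simp
    rw [h1, ← lintegral_add_right _ measurable_const,
      ← lintegral_add_right _ (by fun_prop)]
    refine lintegral_congr fun x => ?_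
    have := hVK x
    unfold shifted
    rcases le_total 0 (V x) with h | h
    · rw [ENNReal.ofReal_of_nonpos (p := -V x) (by linarith), ENNReal.ofReal_add h hK, add_zero]
    · rw [ENNReal.ofReal_of_nonpos (p := V x) h,
        ← ENNReal.ofReal_add this (by linarith)]
      rw [zero_add, add_neg_cancel_comm]
  have hD : ∫⁻ x, ENNReal.ofReal (-V x) ∂μ ≤ ENNReal.ofReal K := by
    calc ∫⁻ x, ENNReal.ofReal (-V x) ∂μ ≤ ∫⁻ _, ENNReal.ofReal K ∂μ :=
          lintegral_mono fun x => ENNReal.ofReal_le_ofReal (by linarith [hVK x])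
      _ = ENNReal.ofReal K := by simp
  unfold IV eIntR shiftedEnergy
  generalize doubleEnergy d μ = E at *
  generalize (∫⁻ x, ENNReal.ofReal (V x) ∂μ) = A at *
  generalize (∫⁻ x, ENNReal.ofReal (-V x) ∂μ) = D at *
  generalize (∫⁻ x, shifted V K x ∂μ) = B at *
  lift D to NNReal using ne_top_of_le_ne_top ENNReal.ofReal_ne_top hD
  have hKr : (K : EReal) = ((ENNReal.ofReal K : ℝ≥0∞) : EReal) := by
    rw [EReal.coe_ennreal_ofReal, max_eq_left hK]
  have h2 : (A : EReal) + K = (B : EReal) + (D : ℝ≥0∞) := by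
    rw [hKr, ← EReal.coe_ennreal_add, hsplit, EReal.coe_ennreal_add]
  have h3 : (A : EReal) - (D : ℝ≥0∞) + K = B := by
    have h4 : (A : EReal) - (D : ℝ≥0∞) + K = ((A : EReal) + K) - (D : ℝ≥0∞) := by
      rw [sub_eq_add_neg, sub_eq_add_neg, add_right_comm]
    rw [h4, h2]
    exact EReal.add_sub_cancel_right (b := (D : ℝ))
  rw [add_assoc, h3, EReal.coe_ennreal_add]

lemma HN3_add {d N : ℕ} {V : Esp d → ℝ} {K : ℝ}
    (hVK : ∀ x, 0 ≤ V x + K) (X : Fin N → Esp d) :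
    HN3 d N V X + ((N * N * K : ℝ) : EReal) = (shiftedHamiltonian d N V K X : EReal) := by
  have h1 : ((N : ℝ≥0∞) * ∑ i, shifted V K (X i))
      = ENNReal.ofReal (N * ∑ i, V (X i) + N * N * K) := by
    unfold shifted
    rw [← ENNReal.ofReal_sum_of_nonneg fun i _ => hVK _, ← ENNReal.ofReal_natCast,
      ← ENNReal.ofReal_mul (Nat.cast_nonneg N)]
    congr 1
    rw [Finset.sum_add_distrib]
    simp
    ring
  have h0 : 0 ≤ (N * ∑ i, V (X i) + N * N * K : ℝ) := by
    have : (N * ∑ i, V (X i) + N * N * K : ℝ) = N * ∑ i, (V (X i) + K) := by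
      rw [Finset.sum_add_distrib]
      simp
      ring
    rw [this]
    exact mul_nonneg (Nat.cast_nonneg N) (Finset.sum_nonneg fun i _ => hVK _)
  unfold HN3 shiftedHamiltonian
  rw [EReal.coe_ennreal_add, h1, EReal.coe_ennreal_ofReal, max_eq_left h0, add_assoc,
    EReal.coe_add]

lemma lintegral_pi_pair {d N : ℕ} (μ : Measure (Esp d)) [IsProbabilityMeasure μ]
    {i j : Fin N} (hij : i ≠ j) :
    ∫⁻ Y : Fin N → Esp d, coulK d (Y i - Y j) ∂(Measure.pi fun _ => μ) = doubleEnergy d μ := by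
  have hind := ProbabilityTheory.iIndepFun_pi (μ := fun _ : Fin N => μ)
    (X := fun _ => id) fun _ => aemeasurable_id
  have hmap := (ProbabilityTheory.indepFun_iff_map_prod_eq_prod_map_map
    (measurable_pi_apply i).aemeasurable (measurable_pi_apply j).aemeasurable).1 (hind.indepFun hij)
  have hev : ∀ k : Fin N, Measure.map (fun Y : Fin N → Esp d => Y k) (Measure.pi fun _ => μ) = μ :=
    fun k => (measurePreserving_eval (fun _ : Fin N => μ) k).map_eq
  rw [hev, hev] at hmap
  unfold doubleEnergy
  have hm := measurable_coulK d
  rw [← hmap, lintegral_map (by fun_prop) (by fun_prop)]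

/-- A minimal shifted Hamiltonian is bounded by its average over independent samples. -/
lemma shiftedHamiltonian_le {d N : ℕ} {V : Esp d → ℝ} {K : ℝ} (hV : Measurable V)
    {X : Fin N → Esp d}
    (hX : ∀ Y, shiftedHamiltonian d N V K X ≤ shiftedHamiltonian d N V K Y)
    (μ : Measure (Esp d)) [IsProbabilityMeasure μ] :
    shiftedHamiltonian d N V K X ≤ N * N * shiftedEnergy d V K μ := by
  have hm := measurable_coulK d
  have hs : Measurable (shifted V K) := by unfold shifted; fun_prop
  have hpair : ∀ i j : Fin N, Measurable fun Y : Fin N → Esp d =>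
      if i ≠ j then coulK d (Y i - Y j) else 0 := fun i j => by
    split_ifs <;> fun_prop
  calc shiftedHamiltonian d N V K X
      = ∫⁻ _, shiftedHamiltonian d N V K X ∂(Measure.pi fun _ : Fin N => μ) := by simp
    _ ≤ ∫⁻ Y, shiftedHamiltonian d N V K Y ∂(Measure.pi fun _ : Fin N => μ) :=
        lintegral_mono fun Y => hX Y
    _ = (∑ i : Fin N, ∑ j : Fin N, if i ≠ j then doubleEnergy d μ else 0)
          + N * ∑ _i : Fin N, ∫⁻ x, shifted V K x ∂μ := by
        unfold shiftedHamiltonian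
        rw [lintegral_add_right _ (by fun_prop), lintegral_const_mul _ (by fun_prop),
          lintegral_finsetSum _ (fun i _ => Finset.measurable_fun_sum _ fun j _ => hpair i j),
          lintegral_finsetSum _ (fun i _ => by fun_prop)]
        congr 1
        · refine Finset.sum_congr rfl fun i _ => ?_
          rw [lintegral_finsetSum _ (fun j _ => hpair i j)]
          refine Finset.sum_congr rfl fun j _ => ?_
          split_ifs with h
          · exact lintegral_pi_pair μ h
          · simp
        · congr 1
          refine Finset.sum_congr rfl fun i _ => ?_
          exact (measurePreserving_eval (fun _ : Fin N => μ) i).lintegral_comp hs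
    _ ≤ (∑ _i : Fin N, ∑ _j : Fin N, doubleEnergy d μ)
          + N * ∑ _i : Fin N, ∫⁻ x, shifted V K x ∂μ := by
        gcongr with i _ j _
        split_ifs <;> simp
    _ = N * N * shiftedEnergy d V K μ := by
        unfold shiftedEnergy
        simp
        ring

/-- The empirical measure of a nonempty configuration. -/
def empirical {d N : ℕ} (X : Fin (N + 1) → Esp d) : ProbabilityMeasure (Esp d) :=
  ⟨((N + 1 : ℕ) : ℝ≥0∞)⁻¹ • ∑ i, Measure.dirac (X i), ⟨by
    simp only [Measure.smul_apply, Measure.coe_finsetSum, Finset.sum_apply, measure_univ,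
      Finset.sum_const, Finset.card_univ, Fintype.card_fin, smul_eq_mul, nsmul_eq_mul, mul_one]
    exact ENNReal.inv_mul_cancel (by simp) (by simp)⟩⟩

lemma lintegral_empirical {d N : ℕ} (X : Fin (N + 1) → Esp d) (f : Esp d → ℝ≥0∞) :
    ∫⁻ x, f x ∂(empirical X : Measure (Esp d))
      = ((N + 1 : ℕ) : ℝ≥0∞)⁻¹ * ∑ i, f (X i) := by
  change ∫⁻ x, f x ∂(((N + 1 : ℕ) : ℝ≥0∞)⁻¹ • ∑ i, Measure.dirac (X i)) = _
  simp [lintegral_smul_measure, lintegral_finsetSum_measure]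

lemma integral_empirical {d N : ℕ} (X : Fin (N + 1) → Esp d)
    (f : BoundedContinuousFunction (Esp d) ℝ) :
    ∫ x, f x ∂(empirical X : Measure (Esp d)) = ((N + 1 : ℕ) : ℝ)⁻¹ * ∑ i, f (X i) := by
  change ∫ x, f x ∂(((N + 1 : ℕ) : ℝ≥0∞)⁻¹ • ∑ i, Measure.dirac (X i)) = _
  rw [integral_smul_measure, integral_finsetSum_measure fun i _ => f.integrable _]
  simp only [integral_dirac, ENNReal.toReal_inv, ENNReal.toReal_natCast, smul_eq_mul]

lemma lintegral_empirical_prod_le {d N : ℕ} {V : Esp d → ℝ} {K : ℝ} (hV : Measurable V)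
    (X : Fin (N + 1) → Esp d) {C : ℝ≥0∞}
    (hC : shiftedHamiltonian d (N + 1) V K X ≤ (N + 1 : ℕ) * (N + 1 : ℕ) * C) (M : ℝ≥0∞) :
    ∫⁻ p, (min (coulK d (p.1 - p.2)) M + shifted V K p.1)
        ∂((empirical X).prod (empirical X) : Measure (Esp d × Esp d))
      ≤ C + ((N + 1 : ℕ) : ℝ≥0∞)⁻¹ * M := by
  have hm := measurable_coulK d
  have hs : Measurable (shifted V K) := by unfold shifted; fun_prop
  set n : ℝ≥0∞ := ((N + 1 : ℕ) : ℝ≥0∞) with hn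
  have hn0 : n ≠ 0 := by simp [hn]
  have hnt : n ≠ ⊤ := by rw [hn]; exact ENNReal.natCast_ne_top _
  have hcancel : n⁻¹ * n = 1 := ENNReal.inv_mul_cancel hn0 hnt
  rw [ProbabilityMeasure.toMeasure_prod, lintegral_prod _ (by fun_prop)]
  simp only [lintegral_empirical]
  have hsum : ∑ i, ∑ j, (min (coulK d (X i - X j)) M + shifted V K (X i))
      ≤ shiftedHamiltonian d (N + 1) V K X + n * M := by
    calc ∑ i, ∑ j, (min (coulK d (X i - X j)) M + shifted V K (X i))
        ≤ ∑ i, ∑ j, ((if i ≠ j then coulK d (X i - X j) else 0) + (if i = j then M else 0)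
            + shifted V K (X i)) := by
          gcongr with i _ j _
          by_cases h : i = j
          · simp [h]
          · simp [h]
      _ = shiftedHamiltonian d (N + 1) V K X + n * M := by
          unfold shiftedHamiltonian
          simp only [Finset.sum_add_distrib, Finset.sum_ite_eq, Finset.mem_univ, if_true,
            Finset.sum_const, Finset.card_univ, Fintype.card_fin, nsmul_eq_mul, ← Finset.mul_sum]
          rw [← hn]
          ring
  calc n⁻¹ * ∑ i, n⁻¹ * ∑ j, (min (coulK d (X i - X j)) M + shifted V K (X i))
      = n⁻¹ * (n⁻¹ * ∑ i, ∑ j, (min (coulK d (X i - X j)) M + shifted V K (X i))) := by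
        rw [← Finset.mul_sum]
    _ ≤ n⁻¹ * (n⁻¹ * (n * n * C + n * M)) := by gcongr; exact hsum.trans (by gcongr)
    _ = (n⁻¹ * n) * (n⁻¹ * n) * C + (n⁻¹ * n) * (n⁻¹ * M) := by ring
    _ = C + n⁻¹ * M := by rw [hcancel]; ring

/-- Any weak limit of empirical measures with asymptotically bounded energy obeys the bound. -/
lemma shiftedEnergy_le_of_tendsto {d : ℕ} {V : Esp d → ℝ} {K : ℝ}
    (hlsc : LowerSemicontinuous V) (hVK : ∀ x, 0 ≤ V x + K)
    {xf : (N : ℕ) → Fin N → Esp d} {C : ℝ≥0∞}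
    (hC : ∀ N : ℕ, shiftedHamiltonian d N V K (xf N) ≤ N * N * C)
    {φ : ℕ → ℕ} (hφ : Tendsto φ atTop atTop) {ν : ProbabilityMeasure (Esp d)}
    (hν : Tendsto (fun n => empirical (xf (φ n + 1))) atTop (𝓝 ν)) :
    shiftedEnergy d V K (ν : Measure (Esp d)) ≤ C := by
  have hV := hlsc.measurable
  have hm := measurable_coulK d
  have hs : Measurable (shifted V K) := by unfold shifted; fun_prop
  have hprod : Tendsto (fun n => (empirical (xf (φ n + 1))).prod (empirical (xf (φ n + 1))))
      atTop (𝓝 (ν.prod ν)) :=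
    (ProbabilityMeasure.continuous_prod.tendsto (ν, ν)).comp (hν.prodMk_nhds hν)
  have htrunc : ∀ M : ℕ, ∫⁻ p, (min (coulK d (p.1 - p.2)) M + shifted V K p.1)
      ∂(ν.prod ν : Measure (Esp d × Esp d)) ≤ C := by
    intro M
    set F : Esp d × Esp d → ℝ := fun p => (min (coulK d (p.1 - p.2)) M).toReal + (V p.1 + K)
      with hF
    have hne : ∀ p : Esp d × Esp d, min (coulK d (p.1 - p.2)) M ≠ ⊤ := fun p =>
      ne_top_of_le_ne_top (ENNReal.natCast_ne_top M) (min_le_right _ _)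
    have hFof : ∀ p, ENNReal.ofReal (F p) = min (coulK d (p.1 - p.2)) M + shifted V K p.1 := by
      intro p
      rw [hF, ENNReal.ofReal_add ENNReal.toReal_nonneg (hVK _), ENNReal.ofReal_toReal (hne p),
        shifted]
    have hcont : Continuous fun p : Esp d × Esp d => (min (coulK d (p.1 - p.2)) M).toReal := by
      have h1 : Continuous fun p : Esp d × Esp d => min (coulK d (p.1 - p.2)) (M : ℝ≥0∞) := by
        unfold coulK
        refine Continuous.min ?_ continuous_const
        exact ENNReal.continuous_rpow_const.comp
          (ENNReal.continuous_ofReal.comp (by fun_prop))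
      exact continuous_iff_continuousAt.2 fun p =>
        (ENNReal.tendsto_toReal (hne p)).comp (h1.tendsto p)
    have hFlsc : LowerSemicontinuous F :=
      hcont.lowerSemicontinuous.add
        ((hlsc.comp continuous_fst).add continuous_const.lowerSemicontinuous)
    have hF0 : 0 ≤ F := fun p => add_nonneg ENNReal.toReal_nonneg (hVK _)
    have key := lintegral_le_liminf_of_lowerSemicontinuous hprod hFlsc hF0
    simp only [hFof] at key
    refine key.trans ?_
    have hlim : Tendsto (fun n => C + ((φ n + 1 : ℕ) : ℝ≥0∞)⁻¹ * M) atTop (𝓝 C) := by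
      have h1 : Tendsto (fun n => ((φ n + 1 : ℕ) : ℝ≥0∞)⁻¹) atTop (𝓝 0) :=
        ENNReal.tendsto_inv_nat_nhds_zero.comp ((tendsto_add_atTop_nat 1).comp hφ)
      have h2 := ENNReal.Tendsto.mul_const (b := (M : ℝ≥0∞)) h1
        (Or.inr (ENNReal.natCast_ne_top M))
      simpa using h2.const_add C
    calc _ ≤ liminf (fun n => C + ((φ n + 1 : ℕ) : ℝ≥0∞)⁻¹ * M) atTop :=
          liminf_le_liminf (Eventually.of_forall fun n =>
            lintegral_empirical_prod_le hV _ (hC _) M)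
      _ = C := hlim.liminf_eq
  have hsup : ∫⁻ p, (coulK d (p.1 - p.2) + shifted V K p.1)
      ∂(ν.prod ν : Measure (Esp d × Esp d)) ≤ C := by
    have hmono : Monotone fun (M : ℕ) (p : Esp d × Esp d) =>
        min (coulK d (p.1 - p.2)) M + shifted V K p.1 := fun a b hab p => by
      dsimp only
      gcongr
    have heq : ∀ p : Esp d × Esp d, coulK d (p.1 - p.2) + shifted V K p.1
        = ⨆ M : ℕ, (min (coulK d (p.1 - p.2)) M + shifted V K p.1) := by
      intro p
      rw [← ENNReal.iSup_add, ← inf_iSup_eq, ENNReal.iSup_natCast, inf_top_eq]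
    simp_rw [heq]
    rw [lintegral_iSup (fun M => by fun_prop) hmono]
    exact iSup_le htrunc
  refine le_trans (le_of_eq ?_) hsup
  rw [ProbabilityMeasure.toMeasure_prod, lintegral_add_right _ (by fun_prop), shiftedEnergy,
    doubleEnergy]
  congr 1
  rw [lintegral_prod _ (by fun_prop)]
  simp

/-- The confinement forced by the growth of `V` at infinity. -/
lemma tendsto_potential {d : ℕ} (hd : 3 ≤ d) {V : Esp d → ℝ}
    (hgrowth : Tendsto (fun x : Esp d => V x / 2 + ‖x‖ ^ (2 - (d : ℝ)))
      (cocompact (Esp d)) atTop) :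
    Tendsto V (cocompact (Esp d)) atTop := by
  have hd' : (3 : ℝ) ≤ d := by exact_mod_cast hd
  have hlarge : ∀ᶠ x : Esp d in cocompact (Esp d), 1 ≤ ‖x‖ :=
    tendsto_norm_cocompact_atTop.eventually_ge_atTop 1
  rw [tendsto_atTop] at hgrowth ⊢
  intro b
  filter_upwards [hgrowth (b / 2 + 1), hlarge] with x hx h1
  have := Real.rpow_le_one_of_one_le_of_nonpos h1 (z := 2 - (d : ℝ)) (by linarith)
  linarith

lemma isTightMeasureSet_empirical {d : ℕ} {V : Esp d → ℝ} {K : ℝ} (hV : Measurable V)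
    (hVlim : Tendsto V (cocompact (Esp d)) atTop)
    {xf : (N : ℕ) → Fin N → Esp d} {C : ℝ≥0∞} (hCt : C ≠ ⊤)
    (hC : ∀ N : ℕ, shiftedHamiltonian d N V K (xf N) ≤ N * N * C) :
    IsTightMeasureSet {((μ : ProbabilityMeasure (Esp d)) : Measure (Esp d)) |
      μ ∈ Set.range fun n => empirical (xf (n + 1))} := by
  have hs : Measurable (shifted V K) := by unfold shifted; fun_prop
  rw [isTightMeasureSet_iff_exists_isCompact_measure_compl_le]
  intro ε hε
  obtain ⟨R, hR0, hRt, hR⟩ : ∃ R : ℝ≥0∞, R ≠ 0 ∧ R ≠ ⊤ ∧ C / R ≤ ε := by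
    obtain ⟨n, hn⟩ := ENNReal.exists_nat_mul_gt hε.ne' hCt
    refine ⟨n, ?_, ENNReal.natCast_ne_top n, ENNReal.div_le_of_le_mul' hn.le⟩
    rintro h
    simp [h] at hn
  have hev : ∀ᶠ x in cocompact (Esp d), R ≤ shifted V K x := by
    filter_upwards [hVlim.eventually_ge_atTop (R.toReal - K)] with x hx
    rw [shifted, ← ENNReal.ofReal_toReal hRt]
    exact ENNReal.ofReal_le_ofReal (by linarith)
  obtain ⟨S, hS, hSsub⟩ := mem_cocompact.1 hev
  refine ⟨S, hS, ?_⟩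
  rintro _ ⟨_, ⟨n, rfl⟩, rfl⟩
  have hint := lintegral_empirical_prod_le hV (xf (n + 1)) (hC (n + 1)) 0
  rw [mul_zero, add_zero, ProbabilityMeasure.toMeasure_prod, lintegral_prod _
    (by have := measurable_coulK d; fun_prop)] at hint
  simp only [min_zero, zero_add, lintegral_const, measure_univ, mul_one] at hint
  calc (empirical (xf (n + 1)) : Measure (Esp d)) Sᶜ
      ≤ (empirical (xf (n + 1)) : Measure (Esp d)) {x | R ≤ shifted V K x} := measure_mono hSsub
    _ ≤ (∫⁻ x, shifted V K x ∂(empirical (xf (n + 1)) : Measure (Esp d))) / R :=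
        meas_ge_le_lintegral_div hs.aemeasurable hR0 hRt
    _ ≤ C / R := by gcongr
    _ ≤ ε := hR

end CoulombGas

/-- convergence of empirical measures of minimizers of `H_N` to the
equilibrium measure: if `(x₁^N,…,x_N^N)` minimizes `H_N` for each `N`, then
`(1/N) Σᵢ δ_{x_i^N} → μ_V` weakly (i.e. against bounded continuous test functions). -/
theorem statement_18 (d : ℕ) (hd : 3 ≤ d) (V : Esp d → ℝ)
    (hlsc : LowerSemicontinuous V)
    (hbd : ∃ c : ℝ, ∀ x, c ≤ V x)
    (hgrowth : Tendsto (fun x : Esp d => V x / 2 + ‖x‖ ^ (2 - (d : ℝ)))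
      (cocompact (Esp d)) atTop)
    (μV : Measure (Esp d)) (hprob : IsProbabilityMeasure μV)
    (hmin : ∀ ν : Measure (Esp d), IsProbabilityMeasure ν → IV d V μV ≤ IV d V ν)
    (huniq : ∀ ν : Measure (Esp d), IsProbabilityMeasure ν →
      IV d V ν = IV d V μV → ν = μV)
    (xf : (N : ℕ) → Fin N → Esp d)
    (hxf : ∀ (N : ℕ) (Y : Fin N → Esp d), HN3 d N V (xf N) ≤ HN3 d N V Y) :
    ∀ f : BoundedContinuousFunction (Esp d) ℝ,
      Tendsto (fun N : ℕ => (N : ℝ)⁻¹ * ∑ i, f (xf N i)) atTop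
        (𝓝 (∫ x, f x ∂μV)) := by
  obtain ⟨c, hc⟩ := hbd
  have hV := hlsc.measurable
  obtain ⟨K, hK, hVK⟩ : ∃ K : ℝ, 0 ≤ K ∧ ∀ x, 0 ≤ V x + K :=
    ⟨|c|, abs_nonneg c, fun x => by linarith [hc x, neg_abs_le c]⟩
  have hIV : ∀ ν : Measure (Esp d), IsProbabilityMeasure ν →
      IV d V ν + (K : EReal) = (CoulombGas.shiftedEnergy d V K ν : EReal) :=
    fun ν _ => CoulombGas.IV_add hV hK hVK ν
  have huniq' : ∀ ν : Measure (Esp d), IsProbabilityMeasure ν →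
      CoulombGas.shiftedEnergy d V K ν ≤ CoulombGas.shiftedEnergy d V K μV → ν = μV := by
    intro ν hν hle
    refine huniq ν hν (le_antisymm ?_ (hmin ν hν))
    rw [← EReal.coe_ennreal_le_coe_ennreal_iff, ← hIV ν hν, ← hIV μV hprob,
      add_comm, add_comm (IV d V μV)] at hle
    exact EReal.addLECancellable_coe K hle
  have hfin : CoulombGas.shiftedEnergy d V K μV ≠ ⊤ := by
    intro htop
    have : NeZero d := ⟨by omega⟩
    obtain ⟨e, he⟩ := exists_ne (0 : Esp d)
    refine dirac_ne_dirac he ?_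
    rw [huniq' (Measure.dirac e) inferInstance (by simp [htop]),
      huniq' (Measure.dirac 0) inferInstance (by simp [htop])]
  have hXmin : ∀ (N : ℕ) (Y : Fin N → Esp d), CoulombGas.shiftedHamiltonian d N V K (xf N)
      ≤ CoulombGas.shiftedHamiltonian d N V K Y := by
    intro N Y
    rw [← EReal.coe_ennreal_le_coe_ennreal_iff, ← CoulombGas.HN3_add hVK, ← CoulombGas.HN3_add hVK]
    exact add_le_add_left (hxf N Y) _
  have hC : ∀ N : ℕ, CoulombGas.shiftedHamiltonian d N V K (xf N)
      ≤ N * N * CoulombGas.shiftedEnergy d V K μV :=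
    fun N => CoulombGas.shiftedHamiltonian_le hV (hXmin N) μV
  have hcomp := isCompact_closure_of_isTightMeasureSet (CoulombGas.isTightMeasureSet_empirical hV
    (CoulombGas.tendsto_potential hd hgrowth) hfin hC)
  have hlim : Tendsto (fun n => CoulombGas.empirical (xf (n + 1))) atTop
      (𝓝 (⟨μV, hprob⟩ : ProbabilityMeasure (Esp d))) := by
    refine tendsto_of_subseq_tendsto fun ns hns => ?_
    obtain ⟨ν, -, φ, hφ, hν⟩ := hcomp.tendsto_subseq
      (x := fun n => CoulombGas.empirical (xf (ns n + 1)))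
      fun n => subset_closure (Set.mem_range_self (ns n))
    refine ⟨φ, ?_⟩
    have hle := CoulombGas.shiftedEnergy_le_of_tendsto hlsc hVK hC
      (hns.comp hφ.tendsto_atTop) hν
    have hνeq : ν = ⟨μV, hprob⟩ := Subtype.ext (huniq' ν inferInstance hle)
    exact hνeq ▸ hν
  intro f
  rw [← tendsto_add_atTop_iff_nat 1]
  have := ProbabilityMeasure.tendsto_iff_forall_integral_tendsto.1 hlim f
  simp only [CoulombGas.integral_empirical] at this
  exact this
end
end
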